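/- arXiv:1812.08770 — 2 statements merged into one kernel-verified Lean document; each statement's English description precedes it below -/
import Mathlib

section
/- Let ψ, h ∈ C^∞(B₂) with 0 < ψ < 1/2 and h ≥ 0, and define f(x) := inf_{y ∈ B̄(x,ψ(x))} h(y). Then f is Lipschitz continuous, and for almost every x ∈ B₁ the following holds: whenever y ∈ B̄(x,ψ(x)) satisfies f(x) = h(y), one has |∇f(x) − ∇h(y)| = |∇h(y)|·|∇ψ(x)|. -/
open MeasureTheory Real Set Metric Filter Topology RealInnerProductSpace
open scoped NNReal ENNReal

noncomputable section

abbrev Spc (d : ℕ) : Type := EuclideanSpace ℝ (Fin d)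

variable {d : ℕ}

/-- Time derivative of a space-time function. -/
def tderiv (f : Spc d × ℝ → ℝ) (p : Spc d × ℝ) : ℝ :=
  deriv (fun s => f (p.1, s)) p.2

/-- Spatial gradient of a space-time function. -/
def sgrad (f : Spc d × ℝ → ℝ) (p : Spc d × ℝ) : Spc d :=
  gradient (fun y => f (y, p.2)) p.1

/-- Spatial Laplacian of a space-time function. -/
def slap (f : Spc d × ℝ → ℝ) (p : Spc d × ℝ) : ℝ :=
  ∑ i : Fin d, iteratedFDeriv ℝ 2 (fun y => f (y, p.2)) p.1
    ![EuclideanSpace.single i 1, EuclideanSpace.single i 1]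

/-- Spatial divergence of a space-time vector field. -/
def sdiv (V : Spc d × ℝ → Spc d) (p : Spc d × ℝ) : ℝ :=
  ∑ i : Fin d, (fderiv ℝ (fun y => V (y, p.2)) p.1 (EuclideanSpace.single i 1)) i

/-- The parabolic cylinder `Q_r = B_r × (-r, r)`. -/
def Qc (d : ℕ) (r : ℝ) : Set (Spc d × ℝ) :=
  (closedBall (0 : Spc d) r) ×ˢ (Ioo (-r) r)

/-- Nonnegative smooth test functions compactly supported in `O`. -/
def IsTestOn (O : Set (Spc d × ℝ)) (φ : Spc d × ℝ → ℝ) : Prop :=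
  ContDiff ℝ (⊤ : ℕ∞) φ ∧ HasCompactSupport φ ∧ tsupport φ ⊆ O ∧ ∀ p, 0 ≤ φ p

/-- `b` is of class `C^{3,1}` with norm at most `K`. -/
def C31Bound (b : Spc d × ℝ → Spc d) (K : ℝ) : Prop :=
  ContDiff ℝ (⊤ : ℕ∞) b ∧ ∀ n : ℕ, n ≤ 4 → ∀ p, ‖iteratedFDeriv ℝ n b p‖ ≤ K

/-- `ρ` is a (bounded continuous nonnegative) weak solution of
`ρ_t = Δ(ρ^m) + ∇·(ρ b)` in the set `O`. -/
def IsWeakSolutionIn (m : ℝ) (b : Spc d × ℝ → Spc d) (ρ : Spc d × ℝ → ℝ)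
    (O : Set (Spc d × ℝ)) : Prop :=
  (∀ p, 0 ≤ ρ p) ∧ Continuous ρ ∧ (∃ M, ∀ p, ρ p ≤ M) ∧
  ∀ φ : Spc d × ℝ → ℝ, IsTestOn O φ →
    (∫ p : Spc d × ℝ,
      (ρ p * tderiv φ p + ρ p ^ m * slap φ p - ρ p * ⟪b p, sgrad φ p⟫)) = 0

/-- `ρ` is a weak solution of the Cauchy problem on `ℝ^d × [0,∞)` with
initial data `ρ₀ ∈ L¹ ∩ L^∞`, `ρ₀ ≥ 0`. -/
def IsWeakSolutionCauchy (m : ℝ) (b : Spc d × ℝ → Spc d)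
    (ρ : Spc d × ℝ → ℝ) (ρ₀ : Spc d → ℝ) : Prop :=
  (∀ p, 0 ≤ ρ p) ∧ Continuous ρ ∧ (∃ M, ∀ p, ρ p ≤ M) ∧
  (∀ x, 0 ≤ ρ₀ x) ∧ Integrable ρ₀ ∧ (∃ M, ∀ x, ρ₀ x ≤ M) ∧
  (∀ x, ρ (x, 0) = ρ₀ x) ∧
  ∀ φ : Spc d × ℝ → ℝ, ContDiff ℝ (⊤ : ℕ∞) φ → HasCompactSupport φ → (∀ p, 0 ≤ φ p) →
    (∫ p in (univ ×ˢ Ioi (0:ℝ)),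
      (ρ p * tderiv φ p + ρ p ^ m * slap φ p - ρ p * ⟪b p, sgrad φ p⟫))
      = ∫ x, ρ₀ x * φ (x, 0)

/-- The pressure `u = m/(m-1) ρ^{m-1}` associated with the density `ρ`. -/
def pressure (m : ℝ) (ρ : Spc d × ℝ → ℝ) : Spc d × ℝ → ℝ :=
  fun p => m / (m - 1) * ρ p ^ (m - 1)

/-- `X x₀ t₀` is the streamline of `-b` through `x₀` at time `t₀`. -/
def IsStreamline (b : Spc d × ℝ → Spc d) (X : Spc d → ℝ → ℝ → Spc d) : Prop :=
  ∀ (x₀ : Spc d) (t₀ : ℝ), X x₀ t₀ 0 = x₀ ∧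
    ∀ s : ℝ, HasDerivAt (X x₀ t₀) (-(b (X x₀ t₀ s, t₀ + s))) s

/-- `Δu ≥ -K` in `O` in the sense of distributions. -/
def DistribLapGE (u : Spc d × ℝ → ℝ) (K : ℝ) (O : Set (Spc d × ℝ)) : Prop :=
  ∀ φ : Spc d × ℝ → ℝ, IsTestOn O φ →
    -K * ∫ p : Spc d × ℝ, φ p ≤ ∫ p : Spc d × ℝ, u p * slap φ p

/-- Positivity set at time `t`. -/
def posSet (u : Spc d × ℝ → ℝ) (t : ℝ) : Set (Spc d) := {x | 0 < u (x, t)}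

/-- Space-time free boundary `Γ(u)`. -/
def fb (u : Spc d × ℝ → ℝ) : Set (Spc d × ℝ) :=
  {p | p.1 ∈ frontier (posSet u p.2)}

/-- Space-time free boundary restricted to positive times. -/
def fbPos (u : Spc d × ℝ → ℝ) : Set (Spc d × ℝ) :=
  {p | 0 < p.2 ∧ p.1 ∈ frontier (posSet u p.2)}

/-- `(x₀,t₀)` is a free boundary point of type two with constants `(Cstar, β, h)`. -/
def IsTypeTwo (X : Spc d → ℝ → ℝ → Spc d) (u : Spc d × ℝ → ℝ)
    (x₀ : Spc d) (t₀ Cstar β h : ℝ) : Prop :=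
  ∀ s ∈ Ioo (0:ℝ) h,
    (∀ x : Spc d, ‖x - X x₀ t₀ (-s)‖ ≤ Cstar * s ^ β → u (x, t₀ - s) = 0) ∧
    (∀ x : Spc d, ‖x - X x₀ t₀ s‖ ≤ Cstar * s ^ β → 0 < u (x, t₀ + s))

/-- `u` is monotone with respect to the spatial cone `W_{θ,μ}` in the set `S`. -/
def ConeMonotone (u : Spc d × ℝ → ℝ) (θ : ℝ) (μ : Spc d)
    (S : Set (Spc d × ℝ)) : Prop :=
  ∀ p : Spc d, p ≠ 0 → Real.cos θ * ‖p‖ ≤ ⟪μ, p⟫ →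
    ∀ (x : Spc d) (t : ℝ), (x, t) ∈ S → (x + p, t) ∈ S → u (x, t) ≤ u (x + p, t)

/-- Condition (ii): `u_t ≤ A (∇_μ u + u + 1)` weakly in `O`. -/
def CondII (u : Spc d × ℝ → ℝ) (μ : Spc d) (A : ℝ) (O : Set (Spc d × ℝ)) : Prop :=
  ∀ φ : Spc d × ℝ → ℝ, IsTestOn O φ →
    -(∫ p : Spc d × ℝ, u p * tderiv φ p) ≤
      A * (-(∫ p : Spc d × ℝ, u p * ⟪μ, sgrad φ p⟫)
        + ∫ p : Spc d × ℝ, (u p + 1) * φ p)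

/-- A point of a closed ball is the centre plus the radius times a vector of the unit ball. -/
theorem exists_eq_add_smul_of_mem_closedBall {E : Type*} [NormedAddCommGroup E] [NormedSpace ℝ E]
    {x y : E} {r : ℝ} (hr : 0 < r) (hy : y ∈ closedBall x r) :
    ∃ ν : E, ‖ν‖ ≤ 1 ∧ y = x + r • ν := by
  refine ⟨r⁻¹ • (y - x), ?_, ?_⟩
  · rw [mem_closedBall, dist_eq_norm] at hy
    rw [norm_smul, norm_inv, Real.norm_of_nonneg hr.le]
    exact inv_mul_le_one_of_le₀ hy hr.le
  · rw [smul_inv_smul₀ hr.ne']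
    abel

theorem add_smul_mem_closedBall {E : Type*} [NormedAddCommGroup E] [NormedSpace ℝ E]
    {x ν : E} {r : ℝ} (hr : 0 < r) (hν : ‖ν‖ ≤ 1) : x + r • ν ∈ closedBall x r := by
  rw [mem_closedBall, dist_eq_norm, add_sub_cancel_left, norm_smul, Real.norm_of_nonneg hr.le]
  exact mul_le_of_le_one_right hr.le hν

/-- At a minimum point of `h` over a ball, the gradient of `h` is antiparallel to the radius. -/
theorem inner_gradient_eq_neg_norm_of_isMinOn_closedBall {E : Type*} [NormedAddCommGroup E]
    [InnerProductSpace ℝ E] [CompleteSpace E] {h : E → ℝ} {x ν g : E} {r : ℝ} (hr : 0 < r)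
    (hν : ‖ν‖ ≤ 1) (hg : HasGradientAt h g (x + r • ν))
    (hmin : IsMinOn h (closedBall x r) (x + r • ν)) :
    ⟪g, ν⟫ = -‖g‖ := by
  have key : ∀ w : E, ‖w‖ ≤ 1 → ⟪g, ν⟫ ≤ ⟪g, w⟫ := by
    intro w hw
    have hseg : segment ℝ (x + r • ν) (x + r • w) ⊆ closedBall x r :=
      (convex_closedBall x r).segment_subset (add_smul_mem_closedBall hr hν)
        (add_smul_mem_closedBall hr hw)
    have h0 := hmin.localize.hasFDerivWithinAt_nonneg hg.hasFDerivAt.hasFDerivWithinAt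
      (sub_mem_posTangentConeAt_of_segment_subset hseg)
    have h1 : (x + r • w) - (x + r • ν) = r • (w - ν) := by rw [smul_sub]; abel
    rw [h1, InnerProductSpace.toDual_apply_apply, inner_smul_right, inner_sub_right] at h0
    linarith [nonneg_of_mul_nonneg_right h0 hr]
  have hcs := neg_le_of_abs_le (abs_real_inner_le_norm g ν)
  have hle : ‖g‖ * ‖ν‖ ≤ ‖g‖ := mul_le_of_le_one_right (norm_nonneg _) hν
  refine le_antisymm ?_ (by linarith)
  rcases eq_or_ne g 0 with rfl | hg0
  · simp
  have hgn : ‖g‖ ≠ 0 := norm_ne_zero_iff.2 hg0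
  have := key (-(‖g‖⁻¹ • g)) (by rw [norm_neg, norm_smul, norm_inv, norm_norm, inv_mul_cancel₀ hgn])
  rw [inner_neg_right, inner_smul_right, real_inner_self_eq_norm_sq] at this
  have e : ‖g‖⁻¹ * ‖g‖ ^ 2 = ‖g‖ := by field_simp
  rwa [e] at this

/-- If `f` is touched from above at `x` by `x' ↦ h (x' + ψ x' • ν)`, this gives its gradient. -/
theorem HasGradientAt.eq_add_inner_smul_of_eventually_le {E : Type*} [NormedAddCommGroup E]
    [InnerProductSpace ℝ E] [CompleteSpace E] {f h ψ : E → ℝ} {x ν a g p : E}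
    (hf : HasGradientAt f a x) (hh : HasGradientAt h g (x + ψ x • ν)) (hψ : HasGradientAt ψ p x)
    (hle : ∀ᶠ x' in 𝓝 x, f x' ≤ h (x' + ψ x' • ν)) (heq : f x = h (x + ψ x • ν)) :
    a = g + ⟪g, ν⟫ • p := by
  have hin := (hasFDerivAt_id x).add (hψ.hasFDerivAt.smul_const ν)
  have hcomp : HasFDerivAt (fun x' => h (x' + ψ x' • ν)) _ x :=
    HasFDerivAt.comp x (g := h) hh.hasFDerivAt hin
  have hmin : IsLocalMin (fun x' => h (x' + ψ x' • ν) - f x') x := by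
    filter_upwards [hle] with x' hx'
    rw [← heq, sub_self]
    exact sub_nonneg.2 hx'
  have h0 := hmin.hasFDerivAt_eq_zero (hcomp.sub hf.hasFDerivAt)
  refine ext_inner_right ℝ fun v => ?_
  have := DFunLike.congr_fun h0 v
  simp at this
  rw [inner_add_left, real_inner_smul_left]
  linarith

/-- Lemma 5.4: the inf-convolution is Lipschitz, and its
gradient satisfies `|∇f(x) - ∇h(y)| = |∇h(y)| |∇ψ(x)|` at a.e. `x ∈ B₁`,
whenever `y ∈ B̄(x,ψ(x))` realizes the infimum. -/
theorem inf_convolution_gradient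
    (d : ℕ) (hd : 1 ≤ d)
    (ψ h : Spc d → ℝ)
    (hψs : ContDiffOn ℝ (⊤ : ℕ∞) ψ (closedBall (0:Spc d) 2))
    (hhs : ContDiffOn ℝ (⊤ : ℕ∞) h (closedBall (0:Spc d) 2))
    (hψr : ∀ x ∈ closedBall (0:Spc d) 2, 0 < ψ x ∧ ψ x < 1/2)
    (hh0 : ∀ x ∈ closedBall (0:Spc d) 2, 0 ≤ h x)
    (f : Spc d → ℝ)
    (hf : ∀ x, f x = sInf (h '' closedBall x (ψ x))) :
    (∃ K : ℝ≥0, LipschitzOnWith K f (closedBall (0:Spc d) 1)) ∧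
    (∀ᵐ x : Spc d, x ∈ closedBall (0:Spc d) 1 →
      ∀ y ∈ closedBall x (ψ x), f x = h y →
        ‖gradient f x - gradient h y‖ = ‖gradient h y‖ * ‖gradient ψ x‖) := by
  have hsub : closedBall (0 : Spc d) 1 ⊆ closedBall 0 2 := closedBall_subset_closedBall (by norm_num)
  have hr : ∀ x ∈ closedBall (0 : Spc d) 1, 0 < ψ x := fun x hx => (hψr x (hsub hx)).1
  have hball : ∀ x ∈ closedBall (0 : Spc d) 1, closedBall x (ψ x) ⊆ ball 0 2 := by
    intro x hx
    have h2 := (hψr x (hsub hx)).2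
    refine closedBall_subset_ball' ?_
    rw [mem_closedBall] at hx
    linarith
  have hcont : ∀ x ∈ closedBall (0 : Spc d) 1, ContinuousOn h (closedBall x (ψ x)) := fun x hx =>
    hhs.continuousOn.mono ((hball x hx).trans ball_subset_closedBall)
  have hle : ∀ x ∈ closedBall (0 : Spc d) 1, ∀ z ∈ closedBall x (ψ x), f x ≤ h z := by
    intro x hx z hz
    rw [hf]
    exact csInf_le ((isCompact_closedBall _ _).bddBelow_image (hcont x hx)) (mem_image_of_mem h hz)
  have hLip : ∃ K : ℝ≥0, LipschitzOnWith K f (closedBall (0 : Spc d) 1) := by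
    obtain ⟨C, hC⟩ := hhs.exists_lipschitzOnWith (by simp) (convex_closedBall _ _)
      (isCompact_closedBall _ _)
    obtain ⟨L, hL⟩ := hψs.exists_lipschitzOnWith (by simp) (convex_closedBall _ _)
      (isCompact_closedBall _ _)
    refine ⟨C * (1 + L), LipschitzOnWith.of_le_add_mul _ fun x hx x' hx' => ?_⟩
    obtain ⟨y, hy, hfy⟩ := (isCompact_closedBall x' (ψ x')).exists_sInf_image_eq
      (nonempty_closedBall.2 (hr x' hx').le) (hcont x' hx')
    rw [← hf] at hfy
    obtain ⟨ν, hν, rfl⟩ := exists_eq_add_smul_of_mem_closedBall (hr x' hx') hy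
    have hz := add_smul_mem_closedBall (x := x) (hr x hx) hν
    have h1 := hle x hx _ hz
    have h2 := hC.le_add_mul (ball_subset_closedBall (hball x hx hz))
      (ball_subset_closedBall (hball x' hx' hy))
    have h3 := hL.dist_le_mul x (hsub hx) x' (hsub hx')
    have h4 : dist (x + ψ x • ν) (x' + ψ x' • ν) ≤ (1 + L) * dist x x' := by
      refine (dist_add_add_le _ _ _ _).trans ?_
      have h5 : dist (ψ x • ν) (ψ x' • ν) ≤ dist (ψ x) (ψ x') := by
        rw [dist_eq_norm, ← sub_smul, norm_smul, dist_eq_norm]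
        exact mul_le_of_le_one_right (norm_nonneg _) hν
      linarith
    have h6 := mul_le_mul_of_nonneg_left h4 C.coe_nonneg
    push_cast
    linarith
  refine ⟨hLip, ?_⟩
  obtain ⟨K, hK⟩ := hLip
  have hsphere : ∀ᵐ x : Spc d, x ∉ sphere (0 : Spc d) 1 :=
    measure_eq_zero_iff_ae_notMem.1
      (Measure.addHaar_sphere_of_ne_zero volume (0 : Spc d) one_ne_zero)
  filter_upwards [hK.ae_differentiableWithinAt_of_mem (μ := volume), hsphere] with x hdiff hxs hx y hy hfy
  have hxb : x ∈ ball (0 : Spc d) 1 :=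
    mem_ball.2 (lt_of_le_of_ne (mem_closedBall.1 hx) hxs)
  have hnhds : closedBall (0 : Spc d) 1 ∈ 𝓝 x :=
    mem_of_superset (isOpen_ball.mem_nhds hxb) ball_subset_closedBall
  have hdf := ((hdiff hx).differentiableAt hnhds).hasGradientAt
  have hdψ := ((hψs.differentiableOn (by simp) x (hsub hx)).differentiableAt
    (mem_of_superset hnhds hsub)).hasGradientAt
  have hdh := ((hhs.differentiableOn (by simp) y
    (ball_subset_closedBall (hball x hx hy))).differentiableAt
    (mem_of_superset (isOpen_ball.mem_nhds (hball x hx hy)) ball_subset_closedBall)).hasGradientAt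
  obtain ⟨ν, hν, rfl⟩ := exists_eq_add_smul_of_mem_closedBall (hr x hx) hy
  have hmin : IsMinOn h (closedBall x (ψ x)) (x + ψ x • ν) := fun z hz => by
    simpa [← hfy] using hle x hx z hz
  have hgrad := hdf.eq_add_inner_smul_of_eventually_le hdh hdψ
    (mem_of_superset hnhds fun x' hx' => hle x' hx' _ (add_smul_mem_closedBall (hr x' hx') hν)) hfy
  have hinner := inner_gradient_eq_neg_norm_of_isMinOn_closedBall (hr x hx) hν hdh hmin
  rw [hinner] at hgrad
  rw [hgrad, add_sub_cancel_left, norm_smul, norm_neg, norm_norm]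

end
end

section
/- Let U be either the closed unit ball B₁ in ℝ^d or all of ℝ^d, let T > 0, and let ψ : U × [0,T] → [0,∞) be a continuous function such that: (a) ψ is smooth on the open set {ψ > 0} and satisfies ψ_t − Δ(ψ^m) − ∇·(b ψ) ≥ 0 pointwise there; (b) ψ^α is Lipschitz continuous for some α ∈ (0,m); and (c) the set Γ(ψ) := ∂{ψ > 0} (in space-time) has Hausdorff dimension d−1. Then ψ is a weak supersolution of ψ_t = Δ(ψ^m) + ∇·(b ψ) on U × [0,T]: for every nonnegative φ ∈ C_c^∞(U × [0,T)), ∫₀^T∫ (ψ ∂_tφ + ψ^m Δφ − ψ b·∇φ) dx dt ≤ ∫ ψ(x,0) φ(x,0) dx. -/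
open MeasureTheory Real Set Metric Filter Topology RealInnerProductSpace
open scoped NNReal ENNReal

noncomputable section

variable {d : ℕ}

theorem exists_ball_cover_of_hausdorffMeasure_eq_zero {X : Type*} [MetricSpace X]
    [MeasurableSpace X] [BorelSpace X] [Nonempty X] {S : Set X} {n : ℝ} (hn : 0 < n)
    (hS : Measure.hausdorffMeasure n S = 0) {ε : ℝ≥0∞} (hε : ε ≠ 0) :
    ∃ (x : ℕ → X) (r : ℕ → ℝ), (∀ i, 0 < r i) ∧ S ⊆ ⋃ i, ball (x i) (r i) ∧
      ∑' i, ENNReal.ofReal (r i) ^ n ≤ ε := by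
  have hε2 : ε / 2 ≠ 0 := (ENNReal.half_pos hε).ne'
  obtain ⟨t, hSt, ht1, hts⟩ : ∃ t : ℕ → Set X, S ⊆ ⋃ i, t i ∧ (∀ i, ediam (t i) ≤ 1) ∧
      ∑' i, ⨆ (_ : (t i).Nonempty), ediam (t i) ^ n < ε / 2 := by
    rw [Measure.hausdorffMeasure_apply] at hS
    have h1 := (iSup_eq_bot.1 (iSup_eq_bot.1 hS 1)) one_pos
    have h2 := h1.trans_lt (pos_iff_ne_zero.2 hε2)
    simp only [iInf_lt_iff] at h2
    obtain ⟨t, a, b, c⟩ := h2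
    exact ⟨t, a, b, c⟩
  obtain ⟨δ, hδ0, hδ⟩ := ENNReal.exists_pos_sum_of_countable' hε2 ℕ
  have key : ∀ i, ∃ (x : X) (ρ : ℝ), 0 < ρ ∧ t i ⊆ ball x ρ ∧
      ENNReal.ofReal ρ ^ n ≤ (⨆ (_ : (t i).Nonempty), ediam (t i) ^ n) + δ i := by
    intro i
    have hfin : ediam (t i) ≠ ⊤ := ((ht1 i).trans_lt ENNReal.one_lt_top).ne
    have hsup : (⨆ (_ : (t i).Nonempty), ediam (t i) ^ n) = ediam (t i) ^ n := by
      rcases (t i).eq_empty_or_nonempty with h | h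
      · simp [h, hn]
      · simp [h]
    have hcont : Continuous fun ρ : ℝ => ENNReal.ofReal ρ ^ n :=
      (ENNReal.continuous_rpow_const).comp ENNReal.continuous_ofReal
    have hlt : ENNReal.ofReal (diam (t i)) ^ n < ediam (t i) ^ n + δ i := by
      rw [Metric.diam, ENNReal.ofReal_toReal hfin]
      exact ENNReal.lt_add_right (ENNReal.rpow_ne_top_of_nonneg hn.le hfin) (hδ0 i).ne'
    have hev : ∀ᶠ ρ in 𝓝[>] diam (t i), ENNReal.ofReal ρ ^ n < ediam (t i) ^ n + δ i :=
      (hcont.continuousAt.eventually_lt continuousAt_const hlt).filter_mono nhdsWithin_le_nhds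
    obtain ⟨ρ, hρ, hdρ⟩ := (hev.and self_mem_nhdsWithin).exists
    have hdρ : diam (t i) < ρ := hdρ
    have hρ0 : 0 < ρ := diam_nonneg.trans_lt hdρ
    rcases (t i).eq_empty_or_nonempty with h | ⟨x, hx⟩
    · exact ⟨Classical.arbitrary X, ρ, hρ0, by simp [h], by rw [hsup]; exact hρ.le⟩
    · refine ⟨x, ρ, hρ0, fun y hy => ?_, by rw [hsup]; exact hρ.le⟩
      exact (dist_le_diam_of_mem' hfin hy hx).trans_lt hdρ
  choose x ρ hρ0 hball hle using key
  refine ⟨x, ρ, hρ0, hSt.trans (iUnion_mono hball), ?_⟩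
  calc ∑' i, ENNReal.ofReal (ρ i) ^ n
      ≤ ∑' i, ((⨆ (_ : (t i).Nonempty), ediam (t i) ^ n) + δ i) := ENNReal.tsum_le_tsum hle
    _ = (∑' i, ⨆ (_ : (t i).Nonempty), ediam (t i) ^ n) + ∑' i, δ i := ENNReal.tsum_add
    _ ≤ ε / 2 + ε / 2 := add_le_add hts.le hδ.le
    _ = ε := ENNReal.add_halves ε

theorem exists_smooth_bump_ball {V : Type*} [NormedAddCommGroup V] [NormedSpace ℝ V]
    [FiniteDimensional ℝ V] [MeasurableSpace V] [BorelSpace V] (μ : Measure V)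
    [μ.IsAddHaarMeasure] {n : ℕ} (hV : Module.finrank ℝ V = n + 1) :
    ∃ C : ℝ, 0 ≤ C ∧ ∀ (x : V) (r : ℝ), 0 < r → ∃ χ : V → ℝ, ContDiff ℝ (⊤ : ℕ∞) χ ∧
      HasCompactSupport χ ∧ (∀ p, χ p ∈ Icc (0 : ℝ) 1) ∧ (∀ p ∈ ball x r, χ p = 1) ∧
      ∫ p, χ p ∂μ ≤ C * r ^ (n + 1) ∧ ∫ p, ‖fderiv ℝ χ p‖ ∂μ ≤ C * r ^ n := by
  let f : ContDiffBump (0 : V) := ⟨1, 2, one_pos, one_lt_two⟩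
  have hf : ContDiff ℝ (⊤ : ℕ∞) f := f.contDiff
  refine ⟨∫ p, f p ∂μ + ∫ p, ‖fderiv ℝ f p‖ ∂μ,
    add_nonneg (integral_nonneg fun p => f.nonneg) (integral_nonneg fun p => norm_nonneg _),
    fun x r hr => ?_⟩
  have hA : ∀ p, HasFDerivAt (fun p : V => r⁻¹ • (p - x)) (r⁻¹ • ContinuousLinearMap.id ℝ V) p :=
    fun p => ((hasFDerivAt_id p).sub_const x).const_smul r⁻¹
  have hfd : ∀ p, ‖fderiv ℝ (fun p => f (r⁻¹ • (p - x))) p‖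
      = r⁻¹ * ‖fderiv ℝ f (r⁻¹ • (p - x))‖ := by
    intro p
    have h := ((hf.differentiable (by simp) (r⁻¹ • (p - x))).hasFDerivAt.comp p (hA p)).fderiv
    have h' : fderiv ℝ (fun p => f (r⁻¹ • (p - x))) p = r⁻¹ • fderiv ℝ f (r⁻¹ • (p - x)) := by
      refine h.trans ?_
      ext v; simp
    rw [h', norm_smul, Real.norm_of_nonneg (inv_nonneg.2 hr.le)]
  have hint : ∀ g : V → ℝ, ∫ p, g (r⁻¹ • (p - x)) ∂μ = r ^ (n + 1) * ∫ p, g p ∂μ := by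
    intro g
    rw [integral_sub_right_eq_self (fun p => g (r⁻¹ • p)) x,
      Measure.integral_comp_inv_smul_of_nonneg μ g hr.le, hV, smul_eq_mul]
  refine ⟨fun p => f (r⁻¹ • (p - x)), hf.comp ((contDiff_id.sub contDiff_const).const_smul _),
    ?_, fun p => ⟨f.nonneg, f.le_one⟩, fun p hp => ?_, ?_, ?_⟩
  · refine HasCompactSupport.intro (isCompact_closedBall x (2 * r)) fun p hp => ?_
    refine f.zero_of_le_dist ?_
    rw [mem_closedBall, not_le, dist_eq_norm] at hp
    rw [dist_zero_right, norm_smul, norm_inv, Real.norm_of_nonneg hr.le, inv_mul_eq_div,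
      le_div_iff₀ hr]
    exact hp.le
  · refine f.one_of_mem_closedBall ?_
    rw [mem_ball, dist_eq_norm] at hp
    rw [mem_closedBall_zero_iff, norm_smul, norm_inv, Real.norm_of_nonneg hr.le, inv_mul_eq_div,
      div_le_iff₀ hr, one_mul]
    exact hp.le
  · rw [hint, mul_comm]
    gcongr
    exact le_add_of_nonneg_right (integral_nonneg fun p => norm_nonneg _)
  · simp_rw [hfd]
    rw [integral_const_mul, hint fun p => ‖fderiv ℝ f p‖, ← mul_assoc, pow_succ,
      mul_comm (r ^ n) r, inv_mul_cancel_left₀ hr.ne', mul_comm]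
    gcongr
    exact le_add_of_nonneg_left (integral_nonneg fun p => f.nonneg)

theorem exists_smooth_cutoff_finset_balls {V : Type*} [NormedAddCommGroup V] [NormedSpace ℝ V]
    [FiniteDimensional ℝ V] [MeasurableSpace V] [BorelSpace V] (μ : Measure V)
    [μ.IsAddHaarMeasure] {n : ℕ} (hV : Module.finrank ℝ V = n + 1) :
    ∃ C : ℝ, 0 ≤ C ∧ ∀ (x : ℕ → V) (r : ℕ → ℝ), (∀ i, 0 < r i) → ∀ s : Finset ℕ,
      ∃ ζ : V → ℝ, ContDiff ℝ (⊤ : ℕ∞) ζ ∧ HasCompactSupport ζ ∧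
      (∀ p, ζ p ∈ Icc (0 : ℝ) 1) ∧ (∀ i ∈ s, ∀ p ∈ ball (x i) (r i), ζ p = 1) ∧
      ∫ p, ζ p ∂μ ≤ C * ∑ i ∈ s, r i ^ (n + 1) ∧
      ∫ p, ‖fderiv ℝ ζ p‖ ∂μ ≤ C * ∑ i ∈ s, r i ^ n := by
  obtain ⟨C, hC, hbump⟩ := exists_smooth_bump_ball μ hV
  refine ⟨C, hC, fun x r hr s => ?_⟩
  induction s using Finset.induction_on with
  | empty => exact ⟨0, contDiff_const, HasCompactSupport.zero, by simp, by simp, by simp, by simp⟩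
  | insert j s hj ih =>
    obtain ⟨ζ, hζ, hζc, hζI, hζ1, hζi, hζd⟩ := ih
    obtain ⟨χ, hχ, hχc, hχI, hχ1, hχi, hχd⟩ := hbump (x j) (r j) (hr j)
    have hcd : ContDiff ℝ (⊤ : ℕ∞) fun p => ζ p + χ p - ζ p * χ p := (hζ.add hχ).sub (hζ.mul hχ)
    have hcs : HasCompactSupport fun p => ζ p + χ p - ζ p * χ p := by
      have := (hζc.add hχc).sub (hζc.mul_right (f' := χ))
      exact this
    have hdζ : Integrable (fun p => ‖fderiv ℝ ζ p‖) μ :=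
      ((hζ.continuous_fderiv (by simp)).norm).integrable_of_hasCompactSupport (hζc.fderiv ℝ).norm
    have hdχ : Integrable (fun p => ‖fderiv ℝ χ p‖) μ :=
      ((hχ.continuous_fderiv (by simp)).norm).integrable_of_hasCompactSupport (hχc.fderiv ℝ).norm
    refine ⟨fun p => ζ p + χ p - ζ p * χ p, hcd, hcs, fun p => ?_, ?_, ?_, ?_⟩
    · obtain ⟨h1, h2⟩ := hζI p
      obtain ⟨h3, h4⟩ := hχI p
      constructor <;> nlinarith
    · intro i hi p hp
      rcases Finset.mem_insert.1 hi with rfl | hi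
      · simp [hχ1 p hp]
      · simp [hζ1 i hi p hp]
    · rw [Finset.sum_insert hj, mul_add, add_comm (C * _)]
      have hζint := hζ.continuous.integrable_of_hasCompactSupport (μ := μ) hζc
      have hχint := hχ.continuous.integrable_of_hasCompactSupport (μ := μ) hχc
      refine le_trans ?_ (add_le_add hζi hχi)
      rw [← integral_add hζint hχint]
      refine integral_mono (hcd.continuous.integrable_of_hasCompactSupport hcs)
        (hζint.add hχint) fun p => ?_
      exact sub_le_self _ (mul_nonneg (hζI p).1 (hχI p).1)
    · rw [Finset.sum_insert hj, mul_add, add_comm (C * _)]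
      refine le_trans ?_ (add_le_add hζd hχd)
      rw [← integral_add hdζ hdχ]
      refine integral_mono (((hcd.continuous_fderiv (by simp)).norm).integrable_of_hasCompactSupport
        (hcs.fderiv ℝ).norm) (hdζ.add hdχ) fun p => ?_
      have h1 := (hζ.differentiable (by simp) p).hasFDerivAt
      have h2 := (hχ.differentiable (by simp) p).hasFDerivAt
      have h3 : fderiv ℝ (fun p => ζ p + χ p - ζ p * χ p) p
          = (1 - χ p) • fderiv ℝ ζ p + (1 - ζ p) • fderiv ℝ χ p := by
        refine ((h1.add h2).sub (h1.mul h2)).fderiv.trans ?_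
        ext v
        simp
        ring
      simp only [h3]
      obtain ⟨h5, h6⟩ := hζI p
      obtain ⟨h7, h8⟩ := hχI p
      refine (norm_add_le _ _).trans (add_le_add ?_ ?_)
      · rw [norm_smul, Real.norm_of_nonneg (by linarith)]
        exact mul_le_of_le_one_left (norm_nonneg _) (by linarith)
      · rw [norm_smul, Real.norm_of_nonneg (by linarith)]
        exact mul_le_of_le_one_left (norm_nonneg _) (by linarith)

/-- A compact set which is null for the codimension-one Hausdorff measure has zero
`W^{1,1}`-capacity. -/
theorem exists_smooth_cutoff_of_hausdorffMeasure_eq_zero {V : Type*} [NormedAddCommGroup V]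
    [NormedSpace ℝ V] [FiniteDimensional ℝ V] [MeasurableSpace V] [BorelSpace V] (μ : Measure V)
    [μ.IsAddHaarMeasure] {n : ℕ} (hn : 1 ≤ n) (hV : Module.finrank ℝ V = n + 1) {S : Set V}
    (hS : IsCompact S) (hS0 : Measure.hausdorffMeasure (n : ℝ) S = 0) {ε : ℝ} (hε : 0 < ε) :
    ∃ ζ : V → ℝ, ContDiff ℝ (⊤ : ℕ∞) ζ ∧ HasCompactSupport ζ ∧ (∀ p, ζ p ∈ Icc (0 : ℝ) 1) ∧
      (∃ N, IsOpen N ∧ S ⊆ N ∧ ∀ p ∈ N, ζ p = 1) ∧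
      ∫ p, ζ p ∂μ ≤ ε ∧ ∫ p, ‖fderiv ℝ ζ p‖ ∂μ ≤ ε := by
  obtain ⟨C, hC, hcut⟩ := exists_smooth_cutoff_finset_balls μ hV
  set η : ℝ := min 1 (ε / (C + 1)) with hη
  have hη0 : 0 < η := lt_min one_pos (by positivity)
  have hCη : C * η ≤ ε := by
    calc C * η ≤ (C + 1) * (ε / (C + 1)) := by
          gcongr
          · linarith
          · exact min_le_right _ _
      _ = ε := by field_simp
  obtain ⟨x, r, hr, hcov, hsum⟩ := exists_ball_cover_of_hausdorffMeasure_eq_zero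
    (by exact_mod_cast hn) hS0 (ENNReal.ofReal_pos.2 hη0).ne'
  obtain ⟨s, hs⟩ := hS.elim_finite_subcover (fun i => ball (x i) (r i)) (fun _ => isOpen_ball) hcov
  have hpow : ∀ t : Finset ℕ, ∑ i ∈ t, r i ^ n ≤ η := by
    intro t
    rw [← ENNReal.ofReal_le_ofReal_iff hη0.le,
      ENNReal.ofReal_sum_of_nonneg fun i _ => (pow_pos (hr i) n).le]
    refine le_trans ?_ ((ENNReal.sum_le_tsum t).trans hsum)
    refine (Finset.sum_congr rfl fun i _ => ?_).le
    rw [ENNReal.rpow_natCast, ENNReal.ofReal_pow (hr i).le]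
  have hr1 : ∀ i, r i ≤ 1 := by
    intro i
    have h1 := hpow {i}
    rw [Finset.sum_singleton] at h1
    by_contra! h
    have := one_lt_pow₀ h (by omega : n ≠ 0)
    linarith [min_le_left 1 (ε / (C + 1))]
  obtain ⟨ζ, h1, h2, h3, h4, h5, h6⟩ := hcut x r hr s
  refine ⟨ζ, h1, h2, h3, ⟨⋃ i ∈ s, ball (x i) (r i),
    isOpen_biUnion fun _ _ => isOpen_ball, hs, fun p hp => ?_⟩, ?_, ?_⟩
  · obtain ⟨i, hi, hp⟩ := mem_iUnion₂.1 hp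
    exact h4 i hi p hp
  · refine h5.trans (le_trans ?_ hCη)
    gcongr
    refine le_trans (Finset.sum_le_sum fun i _ => ?_) (hpow s)
    exact pow_le_pow_of_le_one (hr i).le (hr1 i) (Nat.le_succ n)
  · exact h6.trans ((mul_le_mul_of_nonneg_left (hpow s) hC).trans hCη)

/-- The `i`-th spatial direction in space-time. -/
def spaceDir (i : Fin d) : Spc d × ℝ := (EuclideanSpace.single i 1, 0)

theorem norm_spaceDir (i : Fin d) : ‖spaceDir i‖ = 1 := by
  simp [spaceDir, Prod.norm_def]

/-- The integrand of the weak formulation of `ψ_t = Δv + ∇·(ψ b)` against `φ`, in terms of full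
space-time derivatives. -/
def weakIntegrand (b : Spc d × ℝ → Spc d) (ψ v φ : Spc d × ℝ → ℝ) (p : Spc d × ℝ) : ℝ :=
  ψ p * fderiv ℝ φ p (0, 1)
    + v p * ∑ i, fderiv ℝ (fun q => fderiv ℝ φ q (spaceDir i)) p (spaceDir i)
    - ψ p * ∑ i, b p i * fderiv ℝ φ p (spaceDir i)

theorem contDiff_mul_of_tsupport_subset {V : Type*} [NormedAddCommGroup V] [NormedSpace ℝ V]
    {W : Set V} (hW : IsOpen W) {n : WithTop ℕ∞} {f F : V → ℝ} (hf : ContDiffOn ℝ n f W)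
    (hF : ContDiff ℝ n F) (hFW : tsupport F ⊆ W) : ContDiff ℝ n fun p => f p * F p := by
  rw [contDiff_iff_contDiffAt]
  intro p
  by_cases hp : p ∈ W
  · exact (hf.contDiffAt (hW.mem_nhds hp)).mul hF.contDiffAt
  · have h0 : F =ᶠ[𝓝 p] 0 := notMem_tsupport_iff_eventuallyEq.1 fun h => hp (hFW h)
    refine (contDiffAt_const (c := (0 : ℝ))).congr_of_eventuallyEq ?_
    filter_upwards [h0] with q hq
    simp [hq]

instance isAddHaarMeasure_volume_spacetime :
    (volume : Measure (Spc d × ℝ)).IsAddHaarMeasure :=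
  Measure.prod.instIsAddHaarMeasure volume volume

theorem integral_fderiv_apply_eq_zero {V : Type*} [NormedAddCommGroup V] [NormedSpace ℝ V]
    [FiniteDimensional ℝ V] [MeasurableSpace V] [BorelSpace V] (μ : Measure V)
    [μ.IsAddHaarMeasure] {h : V → ℝ} (hh : ContDiff ℝ 1 h) (hc : HasCompactSupport h) (e : V) :
    Integrable (fun p => fderiv ℝ h p e) μ ∧ ∫ p, fderiv ℝ h p e ∂μ = 0 := by
  have hi : Integrable (fun p => fderiv ℝ h p e) μ :=
    ((hh.continuous_fderiv one_ne_zero).clm_apply continuous_const).integrable_of_hasCompactSupport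
      (hc.fderiv_apply ℝ e)
  refine ⟨hi, ?_⟩
  have := integral_mul_fderiv_eq_neg_fderiv_mul_of_integrable (μ := μ) (f := fun _ => (1 : ℝ))
    (g := h) (v := e) (by simp) (by simpa using hi)
    (by simpa using hh.continuous.integrable_of_hasCompactSupport hc)
    (fun _ _ => differentiableAt_const _) (fun x _ => hh.differentiable one_ne_zero x)
  simpa using this

theorem fderiv_mul_apply {V : Type*} [NormedAddCommGroup V] [NormedSpace ℝ V] {f g : V → ℝ}
    {p : V} (hf : DifferentiableAt ℝ f p) (hg : DifferentiableAt ℝ g p) (e : V) :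
    fderiv ℝ (fun q => f q * g q) p e = f p * fderiv ℝ g p e + g p * fderiv ℝ f p e := by
  have h := (hf.hasFDerivAt.mul hg.hasFDerivAt).fderiv
  exact (congrArg (fun L : V →L[ℝ] ℝ => L e) h).trans (by simp)

theorem tsupport_weakIntegrand_subset (b : Spc d × ℝ → Spc d) (ψ v φ : Spc d × ℝ → ℝ) :
    tsupport (weakIntegrand b ψ v φ) ⊆ tsupport φ := by
  refine closure_minimal (fun p hp => ?_) (isClosed_tsupport φ)
  by_contra h
  refine hp ?_
  have h1 : fderiv ℝ φ p = 0 := by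
    by_contra h'
    exact h (support_fderiv_subset ℝ h')
  have h2 : ∀ i, fderiv ℝ (fun q => fderiv ℝ φ q (spaceDir i)) p = 0 := by
    intro i
    by_contra h'
    exact h (tsupport_fderiv_apply_subset ℝ (spaceDir i) (support_fderiv_subset ℝ h'))
  simp [weakIntegrand, h1, h2]

theorem contDiff_fderiv_apply {V : Type*} [NormedAddCommGroup V] [NormedSpace ℝ V] {φ : V → ℝ}
    (hφ : ContDiff ℝ (⊤ : ℕ∞) φ) (e : V) : ContDiff ℝ (⊤ : ℕ∞) fun q => fderiv ℝ φ q e :=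
  (hφ.fderiv_right (m := (⊤ : ℕ∞)) (by simp)).clm_apply contDiff_const

theorem contDiffOn_fderiv_apply {V : Type*} [NormedAddCommGroup V] [NormedSpace ℝ V] {f : V → ℝ}
    {W : Set V} (hW : IsOpen W) (hf : ContDiffOn ℝ (⊤ : ℕ∞) f W) (e : V) :
    ContDiffOn ℝ (⊤ : ℕ∞) (fun q => fderiv ℝ f q e) W :=
  (hf.fderiv_of_isOpen hW (m := (⊤ : ℕ∞)) (by simp)).clm_apply contDiffOn_const

theorem continuousOn_weakIntegrand {Ω : Set (Spc d × ℝ)} {b : Spc d × ℝ → Spc d}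
    {ψ v φ : Spc d × ℝ → ℝ} (hb : Continuous b) (hψ : ContinuousOn ψ Ω) (hv : ContinuousOn v Ω)
    (hφ : ContDiff ℝ (⊤ : ℕ∞) φ) : ContinuousOn (weakIntegrand b ψ v φ) Ω := by
  have h1 : ∀ e, Continuous fun q => fderiv ℝ φ q e :=
    fun e => (contDiff_fderiv_apply hφ e).continuous
  have h2 : ∀ i, Continuous fun p =>
      fderiv ℝ (fun q => fderiv ℝ φ q (spaceDir i)) p (spaceDir i) :=
    fun i => (contDiff_fderiv_apply (contDiff_fderiv_apply hφ _) _).continuous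
  have hbi : ∀ i, Continuous fun p => b p i := fun i =>
    (EuclideanSpace.proj (𝕜 := ℝ) i).continuous.comp hb
  refine ((hψ.mul (h1 _).continuousOn).add (hv.mul ?_)).sub (hψ.mul ?_)
  · exact (continuous_finsetSum _ fun i _ => h2 i).continuousOn
  · exact (continuous_finsetSum _ fun i _ => (hbi i).mul (h1 _)).continuousOn

theorem continuous_weakIntegrand {Ω : Set (Spc d × ℝ)} (hΩ : IsOpen Ω) {b : Spc d × ℝ → Spc d}
    {ψ v φ : Spc d × ℝ → ℝ} (hb : Continuous b) (hψ : ContinuousOn ψ Ω) (hv : ContinuousOn v Ω)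
    (hφ : ContDiff ℝ (⊤ : ℕ∞) φ) (hφΩ : tsupport φ ⊆ Ω) :
    Continuous (weakIntegrand b ψ v φ) :=
  continuous_of_tsupport fun _ hp =>
    (continuousOn_weakIntegrand hb hψ hv hφ).continuousAt
      (hΩ.mem_nhds (hφΩ (tsupport_weakIntegrand_subset b ψ v φ hp)))

/-- A field whose divergence controls `weakIntegrand` up to terms supported where the cutoff `ζ`
does not vanish. -/
def fluxDiv (b : Spc d × ℝ → Spc d) (ψ v φ ζ : Spc d × ℝ → ℝ) (p : Spc d × ℝ) : ℝ :=
  fderiv ℝ (fun q => ψ q * (φ q * (1 - ζ q))) p (0, 1)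
    + ∑ i, (fderiv ℝ (fun q => v q * (fderiv ℝ φ q (spaceDir i) * (1 - ζ q))) p (spaceDir i)
      - fderiv ℝ (fun q => fderiv ℝ v q (spaceDir i) * (φ q * (1 - ζ q))) p (spaceDir i)
      - fderiv ℝ (fun q => ψ q * b q i * (φ q * (1 - ζ q))) p (spaceDir i))

theorem fluxDiv_eq {b : Spc d × ℝ → Spc d} {ψ v φ ζ : Spc d × ℝ → ℝ} {p : Spc d × ℝ}
    (hb : DifferentiableAt ℝ b p) (hψ : DifferentiableAt ℝ ψ p) (hv : DifferentiableAt ℝ v p)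
    (hv' : ∀ i, DifferentiableAt ℝ (fun q => fderiv ℝ v q (spaceDir i)) p)
    (hφ : DifferentiableAt ℝ φ p)
    (hφ' : ∀ i, DifferentiableAt ℝ (fun q => fderiv ℝ φ q (spaceDir i)) p)
    (hζ : DifferentiableAt ℝ ζ p) :
    fluxDiv b ψ v φ ζ p = φ p * (1 - ζ p) * (fderiv ℝ ψ p (0, 1)
        - ∑ i, fderiv ℝ (fun q => fderiv ℝ v q (spaceDir i)) p (spaceDir i)
        - ∑ i, fderiv ℝ (fun q => ψ q * b q i) p (spaceDir i))
      + (1 - ζ p) * weakIntegrand b ψ v φ p - ψ p * φ p * fderiv ℝ ζ p (0, 1)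
      + ∑ i, (fderiv ℝ v p (spaceDir i) * φ p + ψ p * b p i * φ p
        - v p * fderiv ℝ φ p (spaceDir i)) * fderiv ℝ ζ p (spaceDir i) := by
  have hbi : ∀ i, DifferentiableAt ℝ (fun q => b q i) p := fun i =>
    (EuclideanSpace.proj (𝕜 := ℝ) i).differentiableAt.comp p hb
  have hζ1 : DifferentiableAt ℝ (fun q => 1 - ζ q) p := hζ.const_sub 1
  have hdζ : ∀ e, fderiv ℝ (fun q => 1 - ζ q) p e = -fderiv ℝ ζ p e := by
    intro e; rw [fderiv_const_sub]; simp
  have hF : ∀ e, fderiv ℝ (fun q => φ q * (1 - ζ q)) p e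
      = (1 - ζ p) * fderiv ℝ φ p e - φ p * fderiv ℝ ζ p e := by
    intro e; rw [fderiv_mul_apply hφ hζ1, hdζ]; ring
  have hFd : DifferentiableAt ℝ (fun q => φ q * (1 - ζ q)) p := hφ.mul hζ1
  have hG : ∀ i e, fderiv ℝ (fun q => fderiv ℝ φ q (spaceDir i) * (1 - ζ q)) p e
      = (1 - ζ p) * fderiv ℝ (fun q => fderiv ℝ φ q (spaceDir i)) p e
        - fderiv ℝ φ p (spaceDir i) * fderiv ℝ ζ p e := by
    intro i e; rw [fderiv_mul_apply (hφ' i) hζ1, hdζ]; ring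
  rw [fluxDiv, fderiv_mul_apply hψ hFd, hF]
  have hterm : ∀ i, (fderiv ℝ (fun q => v q * (fderiv ℝ φ q (spaceDir i) * (1 - ζ q))) p
        (spaceDir i)
      - fderiv ℝ (fun q => fderiv ℝ v q (spaceDir i) * (φ q * (1 - ζ q))) p (spaceDir i)
      - fderiv ℝ (fun q => ψ q * b q i * (φ q * (1 - ζ q))) p (spaceDir i))
      = (1 - ζ p) * v p * fderiv ℝ (fun q => fderiv ℝ φ q (spaceDir i)) p (spaceDir i)
        - φ p * (1 - ζ p) * fderiv ℝ (fun q => fderiv ℝ v q (spaceDir i)) p (spaceDir i)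
        - φ p * (1 - ζ p) * fderiv ℝ (fun q => ψ q * b q i) p (spaceDir i)
        - (1 - ζ p) * ψ p * (b p i * fderiv ℝ φ p (spaceDir i))
        + (fderiv ℝ v p (spaceDir i) * φ p + ψ p * b p i * φ p
        - v p * fderiv ℝ φ p (spaceDir i)) * fderiv ℝ ζ p (spaceDir i) := by
    intro i
    have hGd : DifferentiableAt ℝ (fun q => fderiv ℝ φ q (spaceDir i) * (1 - ζ q)) p :=
      (hφ' i).mul hζ1
    have hψb : DifferentiableAt ℝ (fun q => ψ q * b q i) p := hψ.mul (hbi i)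
    rw [fderiv_mul_apply hv hGd, fderiv_mul_apply (hv' i) hFd,
      fderiv_mul_apply hψb hFd, hF, hG]
    ring
  rw [Finset.sum_congr rfl fun i _ => hterm i]
  simp only [Finset.sum_add_distrib, Finset.sum_sub_distrib, ← Finset.mul_sum, weakIntegrand]
  ring

theorem integral_fluxDiv_eq_zero {W : Set (Spc d × ℝ)} (hW : IsOpen W) {b : Spc d × ℝ → Spc d}
    {ψ v φ ζ : Spc d × ℝ → ℝ} (hb : ContDiff ℝ (⊤ : ℕ∞) b) (hψ : ContDiffOn ℝ (⊤ : ℕ∞) ψ W)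
    (hv : ContDiffOn ℝ (⊤ : ℕ∞) v W) (hφ : ContDiff ℝ (⊤ : ℕ∞) φ) (hφc : HasCompactSupport φ)
    (hζ : ContDiff ℝ (⊤ : ℕ∞) ζ) (hsupp : tsupport φ ∩ tsupport (fun q => 1 - ζ q) ⊆ W) :
    Integrable (fluxDiv b ψ v φ ζ) ∧ ∫ p, fluxDiv b ψ v φ ζ p = 0 := by
  have hbi : ∀ i, ContDiff ℝ (⊤ : ℕ∞) fun p => b p i := fun i =>
    (EuclideanSpace.proj (𝕜 := ℝ) i).contDiff.comp hb
  have hζ1 : ContDiff ℝ (⊤ : ℕ∞) fun q => 1 - ζ q := contDiff_const.sub hζ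
  have key : ∀ (f g : Spc d × ℝ → ℝ), ContDiffOn ℝ (⊤ : ℕ∞) f W → ContDiff ℝ (⊤ : ℕ∞) g →
      tsupport g ⊆ tsupport φ → ∀ e,
      Integrable (fun p => fderiv ℝ (fun q => f q * (g q * (1 - ζ q))) p e) ∧
        ∫ p, fderiv ℝ (fun q => f q * (g q * (1 - ζ q))) p e = 0 := by
    intro f g hf hg hgs e
    have hgc : HasCompactSupport g := hφc.of_isClosed_subset (isClosed_tsupport g) hgs
    have hsub : tsupport (fun q => g q * (1 - ζ q)) ⊆ W :=
      (subset_inter (tsupport_mul_subset_left.trans hgs) tsupport_mul_subset_right).trans hsupp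
    exact integral_fderiv_apply_eq_zero volume
      ((contDiff_mul_of_tsupport_subset hW hf (hg.mul hζ1) hsub).of_le (by simp))
      ((hgc.mul_right).mul_left) e
  have k0 := key ψ φ hψ hφ subset_rfl (0, 1)
  have k1 := fun i => key v (fun q => fderiv ℝ φ q (spaceDir i)) hv (contDiff_fderiv_apply hφ _)
    (tsupport_fderiv_apply_subset ℝ _) (spaceDir i)
  have k2 := fun i => key (fun q => fderiv ℝ v q (spaceDir i)) φ
    (contDiffOn_fderiv_apply hW hv _) hφ subset_rfl (spaceDir i)
  have k3 := fun i => key (fun q => ψ q * b q i) φ (hψ.mul (hbi i).contDiffOn) hφ subset_rfl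
    (spaceDir i)
  have ks : ∀ i, Integrable (fun p =>
      fderiv ℝ (fun q => v q * (fderiv ℝ φ q (spaceDir i) * (1 - ζ q))) p (spaceDir i)
      - fderiv ℝ (fun q => fderiv ℝ v q (spaceDir i) * (φ q * (1 - ζ q))) p (spaceDir i)
      - fderiv ℝ (fun q => ψ q * b q i * (φ q * (1 - ζ q))) p (spaceDir i)) ∧ ∫ p,
      (fderiv ℝ (fun q => v q * (fderiv ℝ φ q (spaceDir i) * (1 - ζ q))) p (spaceDir i)
      - fderiv ℝ (fun q => fderiv ℝ v q (spaceDir i) * (φ q * (1 - ζ q))) p (spaceDir i)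
      - fderiv ℝ (fun q => ψ q * b q i * (φ q * (1 - ζ q))) p (spaceDir i)) = 0 := by
    intro i
    refine ⟨((k1 i).1.sub (k2 i).1).sub (k3 i).1, ?_⟩
    refine (integral_sub ((k1 i).1.sub (k2 i).1) (k3 i).1).trans ?_
    rw [(k3 i).2, sub_zero]
    refine (integral_sub (k1 i).1 (k2 i).1).trans ?_
    rw [(k1 i).2, (k2 i).2, sub_zero]
  have kss := integrable_finsetSum (Finset.univ : Finset (Fin d)) fun i _ => (ks i).1
  refine ⟨k0.1.add kss, (integral_add k0.1 kss).trans ?_⟩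
  rw [k0.2, zero_add, integral_finsetSum _ fun i _ => (ks i).1]
  exact Finset.sum_eq_zero fun i _ => (ks i).2

theorem fluxDiv_eq_zero {b : Spc d × ℝ → Spc d} {ψ v φ ζ : Spc d × ℝ → ℝ} {p : Spc d × ℝ}
    (h : (∀ᶠ q in 𝓝 p, φ q = 0) ∨ ∀ᶠ q in 𝓝 p, ζ q = 1) : fluxDiv b ψ v φ ζ p = 0 := by
  have key : ∀ (f g : Spc d × ℝ → ℝ) (e : Spc d × ℝ),
      (∀ᶠ q in 𝓝 p, g q = 0) ∨ (∀ᶠ q in 𝓝 p, ζ q = 1) →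
      fderiv ℝ (fun q => f q * (g q * (1 - ζ q))) p e = 0 := by
    intro f g e h
    have h0 : (fun q => f q * (g q * (1 - ζ q))) =ᶠ[𝓝 p] fun _ => 0 := by
      rcases h with h | h <;> filter_upwards [h] with q hq <;> simp [hq]
    rw [h0.fderiv_eq]
    simp
  have h' : ∀ i, (∀ᶠ q in 𝓝 p, fderiv ℝ φ q (spaceDir i) = 0) ∨ ∀ᶠ q in 𝓝 p, ζ q = 1 := by
    intro i
    refine h.imp_left fun h => ?_
    filter_upwards [eventually_eventually_nhds.2 h] with q hq
    have h0 : φ =ᶠ[𝓝 q] fun _ => 0 := hq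
    rw [h0.fderiv_eq]
    simp
  rw [fluxDiv, key ψ φ _ h, zero_add]
  refine Finset.sum_eq_zero fun i _ => ?_
  rw [key v _ _ (h' i), key _ φ _ h, key (fun q => ψ q * b q i) φ _ h]
  simp

/-- A classical supersolution off a closed set `Γ` of vanishing codimension-one Hausdorff measure
is a weak supersolution, provided the gradient of `v` stays locally bounded. -/
theorem integral_weakIntegrand_nonpos (hd : 1 ≤ d) {Ω Γ : Set (Spc d × ℝ)} (hΩ : IsOpen Ω)
    (hΓ : IsClosed Γ) (hΓ0 : Measure.hausdorffMeasure (d : ℝ) Γ = 0) {b : Spc d × ℝ → Spc d}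
    {ψ v φ : Spc d × ℝ → ℝ} (hb : ContDiff ℝ (⊤ : ℕ∞) b) (hψc : ContinuousOn ψ Ω)
    (hvc : ContinuousOn v Ω) (hψ : ContDiffOn ℝ (⊤ : ℕ∞) ψ (Ω \ Γ))
    (hv : ContDiffOn ℝ (⊤ : ℕ∞) v (Ω \ Γ))
    (hv' : ∀ K ⊆ Ω, IsCompact K → ∃ L, ∀ p ∈ K \ Γ, ‖fderiv ℝ v p‖ ≤ L)
    (hsuper : ∀ p ∈ Ω \ Γ, 0 ≤ fderiv ℝ ψ p (0, 1)
        - ∑ i, fderiv ℝ (fun q => fderiv ℝ v q (spaceDir i)) p (spaceDir i)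
        - ∑ i, fderiv ℝ (fun q => ψ q * b q i) p (spaceDir i))
    (hφ : ContDiff ℝ (⊤ : ℕ∞) φ) (hφc : HasCompactSupport φ) (hφ0 : ∀ p, 0 ≤ φ p)
    (hφΩ : tsupport φ ⊆ Ω) :
    ∫ p, weakIntegrand b ψ v φ p ≤ 0 := by
  have hW : IsOpen (Ω \ Γ) := hΩ.sdiff hΓ
  have hK : IsCompact (tsupport φ) := hφc
  have hQsupp := tsupport_weakIntegrand_subset b ψ v φ
  have hQ : Continuous (weakIntegrand b ψ v φ) :=
    continuous_weakIntegrand hΩ hb.continuous hψc hvc hφ hφΩ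
  have hQc : HasCompactSupport (weakIntegrand b ψ v φ) :=
    hφc.of_isClosed_subset (isClosed_tsupport _) hQsupp
  have hQi : Integrable (weakIntegrand b ψ v φ) := hQ.integrable_of_hasCompactSupport hQc
  obtain ⟨MQ, hMQ⟩ := hK.exists_bound_of_continuousOn hQ.continuousOn
  obtain ⟨Mψ, hMψ⟩ := hK.exists_bound_of_continuousOn (hψc.mono hφΩ)
  obtain ⟨Mv, hMv⟩ := hK.exists_bound_of_continuousOn (hvc.mono hφΩ)
  obtain ⟨Mb, hMb⟩ := hK.exists_bound_of_continuousOn hb.continuous.continuousOn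
  obtain ⟨Mφ, hMφ⟩ := hK.exists_bound_of_continuousOn hφ.continuous.continuousOn
  obtain ⟨M', hM'⟩ := hK.exists_bound_of_continuousOn
    (hφ.continuous_fderiv (by simp)).continuousOn
  obtain ⟨L, hL⟩ := hv' _ hφΩ hK
  set C : ℝ := Mψ * Mφ + ∑ _i : Fin d, (L * Mφ + Mψ * Mb * Mφ + Mv * M') with hC
  have key : ∀ ε : ℝ, 0 < ε → ∫ p, weakIntegrand b ψ v φ p ≤ (|C| + |MQ|) * ε := by
    intro ε hε
    have hS0 : Measure.hausdorffMeasure (d : ℝ) (tsupport φ ∩ Γ) = 0 :=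
      measure_mono_null inter_subset_right hΓ0
    have hrank : Module.finrank ℝ (Spc d × ℝ) = d + 1 := by simp
    obtain ⟨ζ, hζ, hζc, hζI, ⟨N, hN, hSN, hζN⟩, hζi, hζd⟩ :=
      exists_smooth_cutoff_of_hausdorffMeasure_eq_zero (volume : Measure (Spc d × ℝ)) hd hrank
        (hK.inter_right hΓ) hS0 hε
    have hsupp : tsupport φ ∩ tsupport (fun q => 1 - ζ q) ⊆ Ω \ Γ := by
      rintro p ⟨hp, hpζ⟩
      refine ⟨hφΩ hp, fun hpΓ => ?_⟩
      refine (notMem_tsupport_iff_eventuallyEq.2 ?_) hpζ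
      filter_upwards [hN.mem_nhds (hSN ⟨hp, hpΓ⟩)] with q hq
      simp [hζN q hq]
    obtain ⟨hDi, hD0⟩ := integral_fluxDiv_eq_zero hW hb hψ hv hφ hφc hζ hsupp
    have hζint : Integrable ζ := hζ.continuous.integrable_of_hasCompactSupport hζc
    have hdζint : Integrable fun p => ‖fderiv ℝ ζ p‖ :=
      ((hζ.continuous_fderiv (by simp)).norm).integrable_of_hasCompactSupport (hζc.fderiv ℝ).norm
    have hpt : ∀ p, weakIntegrand b ψ v φ p
        ≤ fluxDiv b ψ v φ ζ p + (|C| * ‖fderiv ℝ ζ p‖ + |MQ| * ζ p) := by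
      intro p
      have hrest : 0 ≤ |C| * ‖fderiv ℝ ζ p‖ := by positivity
      have hrest' : 0 ≤ |MQ| * ζ p := mul_nonneg (abs_nonneg _) (hζI p).1
      by_cases hpK : p ∈ tsupport φ
      swap
      · have h1 : weakIntegrand b ψ v φ p = 0 :=
          image_eq_zero_of_notMem_tsupport fun h => hpK (hQsupp h)
        have h2 : fluxDiv b ψ v φ ζ p = 0 :=
          fluxDiv_eq_zero (Or.inl (notMem_tsupport_iff_eventuallyEq.1 hpK))
        rw [h1, h2]
        linarith
      have hQp : |weakIntegrand b ψ v φ p| ≤ |MQ| := (hMQ p hpK).trans (le_abs_self _)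
      by_cases hpΓ : p ∈ Γ
      · have h2 : fluxDiv b ψ v φ ζ p = 0 := fluxDiv_eq_zero
          (Or.inr (by filter_upwards [hN.mem_nhds (hSN ⟨hpK, hpΓ⟩)] with q hq using hζN q hq))
        rw [h2, hζN p (hSN ⟨hpK, hpΓ⟩)]
        linarith [le_abs_self (weakIntegrand b ψ v φ p)]
      have hpW : p ∈ Ω \ Γ := ⟨hφΩ hpK, hpΓ⟩
      have hψp : DifferentiableAt ℝ ψ p :=
        (hψ.contDiffAt (hW.mem_nhds hpW)).differentiableAt (by simp)
      have hvp := (hv.contDiffAt (hW.mem_nhds hpW)).differentiableAt (by simp)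
      have hvp' : ∀ i, DifferentiableAt ℝ (fun q => fderiv ℝ v q (spaceDir i)) p := fun i =>
        ((contDiffOn_fderiv_apply hW hv _).contDiffAt (hW.mem_nhds hpW)).differentiableAt (by simp)
      rw [fluxDiv_eq (hb.differentiable (by simp) p) hψp hvp hvp'
        (hφ.differentiable (by simp) p)
        (fun i => (contDiff_fderiv_apply hφ _).differentiable (by simp) p)
        (hζ.differentiable (by simp) p)]
      have hs := mul_nonneg (mul_nonneg (hφ0 p) (sub_nonneg.2 (hζI p).2)) (hsuper p hpW)
      have hψM := hMψ p hpK
      have hvM := hMv p hpK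
      have hφM := hMφ p hpK
      have hdir : ∀ (A : Spc d × ℝ →L[ℝ] ℝ) (i : Fin d), |A (spaceDir i)| ≤ ‖A‖ := fun A i => by
        simpa [norm_spaceDir] using A.le_opNorm (spaceDir i)
      have hMψ0 : 0 ≤ Mψ := (norm_nonneg _).trans hψM
      have hMv0 : 0 ≤ Mv := (norm_nonneg _).trans hvM
      have hMφ0 : 0 ≤ Mφ := (norm_nonneg _).trans hφM
      have hMb0 : 0 ≤ Mb := (norm_nonneg _).trans (hMb p hpK)
      have hL0 : 0 ≤ L := (norm_nonneg _).trans (hL p ⟨hpK, hpΓ⟩)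
      have htime : |ψ p * φ p * fderiv ℝ ζ p (0, 1)| ≤ Mψ * Mφ * ‖fderiv ℝ ζ p‖ := by
        rw [abs_mul, abs_mul]
        gcongr
        · exact hψM
        · exact hφM
        · simpa [Prod.norm_def] using (fderiv ℝ ζ p).le_opNorm (0, 1)
      have hspace : |∑ i, (fderiv ℝ v p (spaceDir i) * φ p + ψ p * b p i * φ p
          - v p * fderiv ℝ φ p (spaceDir i)) * fderiv ℝ ζ p (spaceDir i)|
          ≤ ∑ _i : Fin d, (L * Mφ + Mψ * Mb * Mφ + Mv * M') * ‖fderiv ℝ ζ p‖ := by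
        refine (Finset.abs_sum_le_sum_abs _ _).trans (Finset.sum_le_sum fun i _ => ?_)
        rw [abs_mul]
        have h1 : |fderiv ℝ v p (spaceDir i) * φ p| ≤ L * Mφ := by
          rw [abs_mul]
          gcongr
          · exact (hdir _ i).trans (hL p ⟨hpK, hpΓ⟩)
          · exact hφM
        have h2 : |ψ p * b p i * φ p| ≤ Mψ * Mb * Mφ := by
          rw [abs_mul, abs_mul]
          gcongr
          · exact hψM
          · exact (PiLp.norm_apply_le (b p) i).trans (hMb p hpK)
          · exact hφM
        have h3 : |v p * fderiv ℝ φ p (spaceDir i)| ≤ Mv * M' := by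
          rw [abs_mul]
          gcongr
          · exact hvM
          · exact (hdir _ i).trans (hM' p hpK)
        refine mul_le_mul ?_ (hdir _ i) (abs_nonneg _) (by
          linarith [abs_nonneg (fderiv ℝ v p (spaceDir i) * φ p), abs_nonneg (ψ p * b p i * φ p),
            abs_nonneg (v p * fderiv ℝ φ p (spaceDir i))])
        exact (abs_sub _ _).trans (add_le_add ((abs_add_le _ _).trans (add_le_add h1 h2)) h3)
      rw [← Finset.sum_mul] at hspace
      have hCle : C * ‖fderiv ℝ ζ p‖ ≤ |C| * ‖fderiv ℝ ζ p‖ := by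
        gcongr
        exact le_abs_self C
      have hQζ : ζ p * weakIntegrand b ψ v φ p ≤ |MQ| * ζ p := by
        rw [mul_comm]
        exact mul_le_mul_of_nonneg_right ((le_abs_self _).trans hQp) (hζI p).1
      have hsplit : C * ‖fderiv ℝ ζ p‖ = Mψ * Mφ * ‖fderiv ℝ ζ p‖
          + (∑ _i : Fin d, (L * Mφ + Mψ * Mb * Mφ + Mv * M')) * ‖fderiv ℝ ζ p‖ := by
        rw [hC, add_mul]
      linarith [neg_abs_le (∑ i, (fderiv ℝ v p (spaceDir i) * φ p + ψ p * b p i * φ p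
          - v p * fderiv ℝ φ p (spaceDir i)) * fderiv ℝ ζ p (spaceDir i)),
        le_abs_self (ψ p * φ p * fderiv ℝ ζ p (0, 1))]
    have hRi : Integrable fun p => |C| * ‖fderiv ℝ ζ p‖ + |MQ| * ζ p :=
      (hdζint.const_mul _).add (hζint.const_mul _)
    calc ∫ p, weakIntegrand b ψ v φ p
        ≤ ∫ p, (fluxDiv b ψ v φ ζ p + (|C| * ‖fderiv ℝ ζ p‖ + |MQ| * ζ p)) :=
          integral_mono hQi (hDi.add hRi) hpt
      _ = |C| * (∫ p, ‖fderiv ℝ ζ p‖) + |MQ| * ∫ p, ζ p := by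
          rw [integral_add hDi hRi, hD0, zero_add,
            integral_add (hdζint.const_mul _) (hζint.const_mul _), integral_const_mul,
            integral_const_mul]
      _ ≤ |C| * ε + |MQ| * ε := by gcongr
      _ = (|C| + |MQ|) * ε := by ring
  refine le_of_forall_pos_le_add fun ε hε => ?_
  rw [zero_add]
  refine (key (ε / (|C| + |MQ| + 1)) (by positivity)).trans ?_
  rw [← mul_div_assoc, div_le_iff₀ (by positivity)]
  nlinarith

theorem tderiv_eq_fderiv {f : Spc d × ℝ → ℝ} {p : Spc d × ℝ} (hf : DifferentiableAt ℝ f p) :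
    tderiv f p = fderiv ℝ f p (0, 1) :=
  (hf.hasFDerivAt.comp_hasDerivAt p.2
    ((hasDerivAt_const p.2 p.1).prodMk (hasDerivAt_id p.2))).deriv

theorem fderiv_slice_apply {f : Spc d × ℝ → ℝ} {p : Spc d × ℝ} (hf : DifferentiableAt ℝ f p)
    (w : Spc d) : fderiv ℝ (fun y => f (y, p.2)) p.1 w = fderiv ℝ f p (w, 0) := by
  have h := (HasFDerivAt.comp (g := f) (f := fun y => (y, p.2)) p.1 hf.hasFDerivAt
    (hasFDerivAt_prodMk_left (𝕜 := ℝ) p.1 p.2)).fderiv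
  exact (congrArg (fun L : Spc d →L[ℝ] ℝ => L w) h).trans (by simp)

theorem slap_eq_sum_fderiv {f : Spc d × ℝ → ℝ} {p : Spc d × ℝ}
    (hf : ContDiffAt ℝ (⊤ : ℕ∞) f p) :
    slap f p = ∑ i, fderiv ℝ (fun q => fderiv ℝ f q (spaceDir i)) p (spaceDir i) := by
  have hslice : ContDiffAt ℝ (⊤ : ℕ∞) (fun y => f (y, p.2)) p.1 :=
    hf.comp (f := fun y => (y, p.2)) p.1 (contDiffAt_id.prodMk contDiffAt_const)
  refine Finset.sum_congr rfl fun i _ => ?_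
  have hd2 : DifferentiableAt ℝ (fderiv ℝ fun y => f (y, p.2)) p.1 :=
    (hslice.fderiv_right (m := (⊤ : ℕ∞)) (by simp)).differentiableAt (by simp)
  have hF : DifferentiableAt ℝ (fun q => fderiv ℝ f q (spaceDir i)) p :=
    ((hf.fderiv_right (m := (⊤ : ℕ∞)) (by simp)).differentiableAt (by simp)).clm_apply
      (differentiableAt_const _)
  have hev : (fun y => fderiv ℝ (fun y => f (y, p.2)) y (EuclideanSpace.single i 1))
      =ᶠ[𝓝 p.1] fun y => fderiv ℝ f (y, p.2) (spaceDir i) := by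
    have h1 : ∀ᶠ q in 𝓝 p, DifferentiableAt ℝ f q :=
      ((hf.of_le (m := 1) (by simp)).eventually (by simp)).mono
        fun q hq => hq.differentiableAt one_ne_zero
    have h2 : Tendsto (fun y => (y, p.2)) (𝓝 p.1) (𝓝 p) :=
      (Continuous.prodMk_left p.2).tendsto p.1
    filter_upwards [h2.eventually h1] with y hy
    exact fderiv_slice_apply hy _
  rw [iteratedFDeriv_two_apply]
  have h3 := fderiv_clm_apply hd2 (differentiableAt_const (EuclideanSpace.single i (1 : ℝ)))
  have h4 := congrArg (fun L : Spc d →L[ℝ] ℝ => L (EuclideanSpace.single i 1)) h3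
  rw [hev.fderiv_eq] at h4
  simp only [fderiv_fun_const] at h4
  have h5 := fderiv_slice_apply hF (EuclideanSpace.single i 1)
  simp only [Matrix.cons_val_zero, Matrix.cons_val_one]
  refine Eq.trans ?_ (h4.symm.trans h5)
  simp

theorem sdiv_smul_eq_sum_fderiv {ψ : Spc d × ℝ → ℝ} {b : Spc d × ℝ → Spc d} {p : Spc d × ℝ}
    (hψ : DifferentiableAt ℝ ψ p) (hb : DifferentiableAt ℝ b p) :
    sdiv (fun q => ψ q • b q) p = ∑ i, fderiv ℝ (fun q => ψ q * b q i) p (spaceDir i) := by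
  refine Finset.sum_congr rfl fun i _ => ?_
  have hbi : DifferentiableAt ℝ (fun q => b q i) p :=
    (EuclideanSpace.proj (𝕜 := ℝ) i).differentiableAt.comp p hb
  have hψb : DifferentiableAt ℝ (fun q => ψ q * b q i) p := hψ.mul hbi
  have hV : DifferentiableAt ℝ (fun y => ψ (y, p.2) • b (y, p.2)) p.1 :=
    (hψ.smul hb).comp (f := fun y => (y, p.2)) p.1
      (differentiableAt_id.prodMk (differentiableAt_const _))
  rw [spaceDir, ← fderiv_slice_apply hψb]
  have h := ((EuclideanSpace.proj (𝕜 := ℝ) i).hasFDerivAt.comp p.1 hV.hasFDerivAt).fderiv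
  exact ((congrArg (fun L : Spc d →L[ℝ] ℝ => L (EuclideanSpace.single i 1)) h).trans rfl).symm

theorem inner_sgrad_eq_sum_fderiv {φ : Spc d × ℝ → ℝ} {p : Spc d × ℝ}
    (hφ : DifferentiableAt ℝ φ p) (w : Spc d) :
    ⟪w, sgrad φ p⟫ = ∑ i, w i * fderiv ℝ φ p (spaceDir i) := by
  have h1 : ⟪w, sgrad φ p⟫ = fderiv ℝ (fun y => φ (y, p.2)) p.1 w := by
    rw [real_inner_comm, sgrad, gradient, InnerProductSpace.toDual_symm_apply]
  have h2 : w = ∑ i, w i • EuclideanSpace.single i (1 : ℝ) := by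
    simpa using ((EuclideanSpace.basisFun (Fin d) ℝ).sum_repr w).symm
  rw [h1]
  conv_lhs => rw [h2]
  rw [map_sum]
  refine Finset.sum_congr rfl fun i _ => ?_
  rw [map_smul, smul_eq_mul, fderiv_slice_apply hφ, spaceDir]

theorem weakIntegrand_eq {b : Spc d × ℝ → Spc d} {ψ v φ : Spc d × ℝ → ℝ}
    (hφ : ContDiff ℝ (⊤ : ℕ∞) φ) (p : Spc d × ℝ) :
    weakIntegrand b ψ v φ p
      = ψ p * tderiv φ p + v p * slap φ p - ψ p * ⟪b p, sgrad φ p⟫ := by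
  have h := hφ.differentiable (by simp) p
  rw [weakIntegrand, tderiv_eq_fderiv h, slap_eq_sum_fderiv hφ.contDiffAt,
    inner_sgrad_eq_sum_fderiv h]

theorem exists_lipschitzOnWith_rpow {X : Type*} [PseudoMetricSpace X] {ψ : X → ℝ} {K : Set X}
    {a m M : ℝ} (ha : 0 < a) (ham : a ≤ m) (hψ0 : ∀ p, 0 ≤ ψ p) (hM : ∀ p ∈ K, ψ p ≤ M)
    {L : ℝ≥0} (hL : LipschitzOnWith L (fun p => ψ p ^ a) K) :
    ∃ L', LipschitzOnWith L' (fun p => ψ p ^ m) K := by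
  set r := m / a
  have hr : 1 ≤ r := (one_le_div ha).2 ham
  have hpow : LipschitzOnWith (Real.toNNReal (r * (M ^ a) ^ (r - 1))) (fun x : ℝ => x ^ r)
      (Icc 0 (M ^ a)) := by
    refine (convex_Icc _ _).lipschitzOnWith_of_nnnorm_hasDerivWithin_le
      (fun x _ => (Real.hasDerivAt_rpow_const (Or.inr hr)).hasDerivWithinAt) fun x hx => ?_
    rw [← NNReal.coe_le_coe, coe_nnnorm]
    refine le_trans ?_ (Real.le_coe_toNNReal _)
    have hx0 : 0 ≤ x ^ (r - 1) := Real.rpow_nonneg hx.1 _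
    rw [Real.norm_of_nonneg (by positivity)]
    gcongr
    · exact hx.1
    · exact hx.2
  have hmaps : MapsTo (fun p => ψ p ^ a) K (Icc 0 (M ^ a)) := fun p hp =>
    ⟨Real.rpow_nonneg (hψ0 p) _, Real.rpow_le_rpow (hψ0 p) (hM p hp) ha.le⟩
  have heq : (fun p => ψ p ^ m) = (fun x : ℝ => x ^ r) ∘ fun p => ψ p ^ a := by
    funext p
    rw [Function.comp_apply, ← Real.rpow_mul (hψ0 p), mul_div_cancel₀ m ha.ne']
  exact ⟨_, heq ▸ hpow.comp hL hmaps⟩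

theorem eventually_eq_zero_of_notMem_frontier {X : Type*} [TopologicalSpace X] {ψ : X → ℝ}
    (hψ0 : ∀ p, 0 ≤ ψ p) {p : X} (hp : p ∉ frontier {p | 0 < ψ p}) (hp0 : ¬ 0 < ψ p) :
    ∀ᶠ q in 𝓝 p, ψ q = 0 := by
  have hint : p ∉ interior {q | 0 < ψ q} := notMem_subset interior_subset hp0
  have h : p ∉ closure {q | 0 < ψ q} := fun h => hp ⟨h, hint⟩
  filter_upwards [isClosed_closure.isOpen_compl.mem_nhds h] with q hq
  exact le_antisymm (not_lt.1 fun h' => hq (subset_closure h')) (hψ0 q)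

theorem eventually_pos_of_notMem_frontier {X : Type*} [TopologicalSpace X] {ψ : X → ℝ}
    {p : X} (hp : p ∉ frontier {p | 0 < ψ p}) (hp0 : 0 < ψ p) :
    {p | 0 < ψ p} ∈ 𝓝 p := by
  by_contra h
  exact hp ⟨subset_closure (by exact hp0), fun h' => h (mem_interior_iff_mem_nhds.1 h')⟩

/-- The map `(x, t) ↦ (l x, t)`. -/
def scaleSpace (l : ℝ) : Spc d × ℝ →L[ℝ] Spc d × ℝ :=
  (l • ContinuousLinearMap.fst ℝ (Spc d) ℝ).prod (ContinuousLinearMap.snd ℝ (Spc d) ℝ)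

theorem scaleSpace_apply (l : ℝ) (p : Spc d × ℝ) : scaleSpace l p = (l • p.1, p.2) := rfl

/-- The part of `weakIntegrand` for the test function `φ ∘ scaleSpace l`. -/
def scaledIntegrand (b : Spc d × ℝ → Spc d) (ψ v φ : Spc d × ℝ → ℝ) (l : ℝ) (p : Spc d × ℝ) :
    ℝ :=
  ψ p * fderiv ℝ φ (scaleSpace l p) (0, 1)
    + v p * (l ^ 2 * ∑ i, fderiv ℝ (fun q => fderiv ℝ φ q (spaceDir i)) (scaleSpace l p)
      (spaceDir i))
    - ψ p * (l * ∑ i, b p i * fderiv ℝ φ (scaleSpace l p) (spaceDir i))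

theorem scaledIntegrand_one (b : Spc d × ℝ → Spc d) (ψ v φ : Spc d × ℝ → ℝ) (p : Spc d × ℝ) :
    scaledIntegrand b ψ v φ 1 p = weakIntegrand b ψ v φ p := by
  simp [scaledIntegrand, weakIntegrand, scaleSpace_apply]

theorem fderiv_time_mul_scale {φ : Spc d × ℝ → ℝ} {θ : ℝ → ℝ} (hφ : Differentiable ℝ φ)
    (hθ : Differentiable ℝ θ) (l : ℝ) (p w : Spc d × ℝ) :
    fderiv ℝ (fun q => θ q.2 * φ (scaleSpace l q)) p w
      = θ p.2 * fderiv ℝ φ (scaleSpace l p) (scaleSpace l w)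
        + φ (scaleSpace l p) * (deriv θ p.2 * w.2) := by
  have h1 : HasFDerivAt (fun q : Spc d × ℝ => θ q.2) _ p :=
    (hθ p.2).hasDerivAt.comp_hasFDerivAt p
      (ContinuousLinearMap.snd ℝ (Spc d) ℝ).hasFDerivAt
  have h2 : HasFDerivAt (fun q => φ (scaleSpace l q)) _ p :=
    (hφ (scaleSpace l p)).hasFDerivAt.comp p (scaleSpace l).hasFDerivAt
  rw [fderiv_mul_apply h1.differentiableAt h2.differentiableAt, h1.fderiv, h2.fderiv]
  simp

theorem spaceDir_snd (i : Fin d) : (spaceDir i).2 = 0 := rfl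

theorem scaleSpace_spaceDir (l : ℝ) (i : Fin d) :
    scaleSpace l (spaceDir i) = l • spaceDir i := by
  simp [scaleSpace_apply, spaceDir]

theorem weakIntegrand_time_mul_scale {b : Spc d × ℝ → Spc d} {ψ v φ : Spc d × ℝ → ℝ}
    {θ : ℝ → ℝ} (hφ : ContDiff ℝ (⊤ : ℕ∞) φ) (hθ : Differentiable ℝ θ) (l : ℝ)
    (p : Spc d × ℝ) :
    weakIntegrand b ψ v (fun q => θ q.2 * φ (scaleSpace l q)) p
      = θ p.2 * scaledIntegrand b ψ v φ l p
        + ψ p * (deriv θ p.2 * φ (scaleSpace l p)) := by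
  have hdφ := hφ.differentiable (by simp)
  have h1 : ∀ i q, fderiv ℝ (fun q => θ q.2 * φ (scaleSpace l q)) q (spaceDir i)
      = l * (θ q.2 * fderiv ℝ φ (scaleSpace l q) (spaceDir i)) := by
    intro i q
    rw [fderiv_time_mul_scale hdφ hθ, scaleSpace_spaceDir, map_smul, smul_eq_mul, spaceDir_snd]
    ring
  have h2 : ∀ i, fderiv ℝ (fun q => fderiv ℝ (fun q => θ q.2 * φ (scaleSpace l q)) q
      (spaceDir i)) p (spaceDir i) = l ^ 2 * (θ p.2 *
        fderiv ℝ (fun q => fderiv ℝ φ q (spaceDir i)) (scaleSpace l p) (spaceDir i)) := by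
    intro i
    have hd : Differentiable ℝ fun q => fderiv ℝ φ q (spaceDir i) :=
      (contDiff_fderiv_apply hφ _).differentiable (by simp)
    have hdi : Differentiable ℝ fun q : Spc d × ℝ =>
        θ q.2 * fderiv ℝ φ (scaleSpace l q) (spaceDir i) :=
      (hθ.comp differentiable_snd).mul (hd.comp (scaleSpace l).differentiable)
    simp_rw [h1]
    rw [fderiv_const_mul (hdi p) l, smul_apply, smul_eq_mul,
      fderiv_time_mul_scale hd hθ, scaleSpace_spaceDir, map_smul, smul_eq_mul, spaceDir_snd]
    ring
  have h3 : fderiv ℝ (fun q => θ q.2 * φ (scaleSpace l q)) p (0, 1)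
      = θ p.2 * fderiv ℝ φ (scaleSpace l p) (0, 1) + φ (scaleSpace l p) * deriv θ p.2 := by
    rw [fderiv_time_mul_scale hdφ hθ]
    simp [scaleSpace_apply]
  have h4 : ∀ i, b p i * (l * (θ p.2 * fderiv ℝ φ (scaleSpace l p) (spaceDir i)))
      = l * θ p.2 * (b p i * fderiv ℝ φ (scaleSpace l p) (spaceDir i)) := fun i => by ring
  rw [weakIntegrand, scaledIntegrand, Finset.sum_congr rfl fun i _ => h2 i, h3]
  simp only [h1, h4, ← Finset.mul_sum]
  ring

theorem contDiffAt_of_notMem_frontier {V : Type*} [NormedAddCommGroup V] [NormedSpace ℝ V]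
    {n : WithTop ℕ∞} {ψ : V → ℝ} {m : ℝ} (hm : m ≠ 0) (hψ0 : ∀ p, 0 ≤ ψ p)
    (hψ : ContDiffOn ℝ n ψ {p | 0 < ψ p}) {p : V} (hp : p ∉ frontier {p | 0 < ψ p}) :
    ContDiffAt ℝ n ψ p ∧ ContDiffAt ℝ n (fun q => ψ q ^ m) p := by
  by_cases hp0 : 0 < ψ p
  · have h := hψ.contDiffAt (eventually_pos_of_notMem_frontier hp hp0)
    exact ⟨h, h.rpow_const_of_ne hp0.ne'⟩
  · have h := eventually_eq_zero_of_notMem_frontier hψ0 hp hp0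
    refine ⟨(contDiffAt_const (c := (0 : ℝ))).congr_of_eventuallyEq h,
      (contDiffAt_const (c := (0 : ℝ))).congr_of_eventuallyEq ?_⟩
    filter_upwards [h] with q hq
    rw [hq, Real.zero_rpow hm]

theorem fderiv_apply_fderiv_apply_eq_zero {V : Type*} [NormedAddCommGroup V] [NormedSpace ℝ V]
    {f : V → ℝ} {p : V} (hf : f =ᶠ[𝓝 p] 0) (e : V) :
    fderiv ℝ (fun q => fderiv ℝ f q e) p e = 0 := by
  have h : (fun q => fderiv ℝ f q e) =ᶠ[𝓝 p] 0 := by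
    filter_upwards [hf.fderiv (𝕜 := ℝ)] with q hq
    simp [hq]
  simp [h.fderiv_eq]

theorem supersolution_of_notMem_frontier {b : Spc d × ℝ → Spc d} {ψ : Spc d × ℝ → ℝ} {m : ℝ}
    (hm : m ≠ 0) (hb : Differentiable ℝ b) (hψ0 : ∀ p, 0 ≤ ψ p)
    (hψ : ContDiffOn ℝ (⊤ : ℕ∞) ψ {p | 0 < ψ p}) {p : Spc d × ℝ}
    (hp : p ∉ frontier {p | 0 < ψ p})
    (hsuper : 0 < ψ p →
      0 ≤ tderiv ψ p - slap (fun q => ψ q ^ m) p - sdiv (fun q => ψ q • b q) p) :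
    0 ≤ fderiv ℝ ψ p (0, 1)
      - ∑ i, fderiv ℝ (fun q => fderiv ℝ (fun q => ψ q ^ m) q (spaceDir i)) p (spaceDir i)
      - ∑ i, fderiv ℝ (fun q => ψ q * b q i) p (spaceDir i) := by
  obtain ⟨h1, h2⟩ := contDiffAt_of_notMem_frontier hm hψ0 hψ hp
  have hd := h1.differentiableAt (by simp)
  by_cases hp0 : 0 < ψ p
  · rw [← tderiv_eq_fderiv hd, ← slap_eq_sum_fderiv h2, ← sdiv_smul_eq_sum_fderiv hd (hb p)]
    exact hsuper hp0
  · have h : ψ =ᶠ[𝓝 p] 0 := eventually_eq_zero_of_notMem_frontier hψ0 hp hp0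
    have hv : (fun q => ψ q ^ m) =ᶠ[𝓝 p] 0 := by
      filter_upwards [h] with q hq
      rw [hq, Pi.zero_apply, Real.zero_rpow hm]
    have hψb : ∀ i, fderiv ℝ (fun q => ψ q * b q i) p = 0 := fun i => by
      have h' : (fun q => ψ q * b q i) =ᶠ[𝓝 p] 0 := by
        filter_upwards [h] with q hq
        simp [hq]
      simp [h'.fderiv_eq]
    simp [h.fderiv_eq, fderiv_apply_fderiv_apply_eq_zero hv, hψb]

theorem exists_norm_fderiv_le_of_rpow_lipschitz {V : Type*} [NormedAddCommGroup V]
    [NormedSpace ℝ V] [LocallyCompactSpace V] {ψ : V → ℝ} {a m : ℝ} (ha : 0 < a) (ham : a ≤ m)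
    (hψ0 : ∀ p, 0 ≤ ψ p) {Ω K : Set V} (hΩ : IsOpen Ω) (hψc : ContinuousOn ψ Ω)
    {L : ℝ≥0} (hL : LipschitzOnWith L (fun p => ψ p ^ a) Ω) (hKΩ : K ⊆ Ω) (hK : IsCompact K) :
    ∃ C, ∀ p ∈ K, ‖fderiv ℝ (fun q => ψ q ^ m) p‖ ≤ C := by
  obtain ⟨K', hK', hKK', hK'Ω⟩ := exists_compact_between hK hΩ hKΩ
  obtain ⟨M, hM⟩ := hK'.exists_bound_of_continuousOn (hψc.mono hK'Ω)
  obtain ⟨L', hL'⟩ := exists_lipschitzOnWith_rpow ha ham hψ0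
    (fun p hp => (le_abs_self _).trans (hM p hp)) (hL.mono hK'Ω)
  exact ⟨L', fun p hp => norm_fderiv_le_of_lipschitzOn ℝ (mem_interior_iff_mem_nhds.1 (hKK' hp))
    hL'⟩

theorem mem_interior_of_smul_mem {U : Set (Spc d)} (hU : U = closedBall (0 : Spc d) 1 ∨ U = univ)
    {l : ℝ} (hl : 1 < l) {x : Spc d} (hx : l • x ∈ U) : x ∈ interior U := by
  rcases hU with rfl | rfl
  · refine ball_subset_interior_closedBall ?_
    rw [mem_closedBall_zero_iff, norm_smul, Real.norm_of_nonneg (by linarith)] at hx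
    rw [mem_ball_zero_iff]
    nlinarith [norm_nonneg x]
  · simp

/-- A smooth nondecreasing function vanishing for `t ≤ 1 / c` and equal to one for `t ≥ 2 / c`. -/
def timeCutoff (c t : ℝ) : ℝ := Real.smoothTransition (c * t - 1)

theorem contDiff_timeCutoff (c : ℝ) : ContDiff ℝ (⊤ : ℕ∞) (timeCutoff c) :=
  Real.smoothTransition.contDiff.comp ((contDiff_const.mul contDiff_id).sub contDiff_const)

theorem monotone_timeCutoff {c : ℝ} (hc : 0 ≤ c) : Monotone (timeCutoff c) := fun s t h =>
  Real.smoothTransition.monotone (by gcongr)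

theorem le_of_timeCutoff_ne_zero {c t : ℝ} (h : timeCutoff c t ≠ 0) : 1 ≤ c * t := by
  by_contra! h'
  exact h (Real.smoothTransition.zero_of_nonpos (by linarith))

theorem tendsto_timeCutoff {t : ℝ} (ht : 0 < t) :
    Tendsto (fun n : ℕ => timeCutoff (n + 1) t) atTop (𝓝 1) := by
  refine tendsto_const_nhds.congr' ?_
  obtain ⟨N, hN⟩ := exists_nat_gt (2 / t)
  filter_upwards [eventually_ge_atTop N] with n hn
  have h1 : (N : ℝ) ≤ n := by exact_mod_cast hn
  have h2 : 2 < N * t := (div_lt_iff₀ ht).1 hN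
  exact (Real.smoothTransition.one_of_one_le (by nlinarith)).symm

theorem continuousOn_scaledIntegrand {S : Set (Spc d × ℝ)} {b : Spc d × ℝ → Spc d}
    {ψ v φ : Spc d × ℝ → ℝ} (hb : Continuous b) (hψ : ContinuousOn ψ S) (hv : ContinuousOn v S)
    (hφ : ContDiff ℝ (⊤ : ℕ∞) φ) :
    ContinuousOn (fun z : ℝ × (Spc d × ℝ) => scaledIntegrand b ψ v φ z.1 z.2) (univ ×ˢ S) := by
  have hs : Continuous fun z : ℝ × (Spc d × ℝ) => scaleSpace z.1 z.2 := by
    simp only [scaleSpace_apply]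
    fun_prop
  have h1 : ∀ e, Continuous fun z : ℝ × (Spc d × ℝ) => fderiv ℝ φ (scaleSpace z.1 z.2) e :=
    fun e => (contDiff_fderiv_apply hφ e).continuous.comp hs
  have h2 : ∀ e, Continuous fun z : ℝ × (Spc d × ℝ) =>
      fderiv ℝ (fun q => fderiv ℝ φ q e) (scaleSpace z.1 z.2) e :=
    fun e => (contDiff_fderiv_apply (contDiff_fderiv_apply hφ e) e).continuous.comp hs
  have hψ' : ContinuousOn (fun z : ℝ × (Spc d × ℝ) => ψ z.2) (univ ×ˢ S) :=
    hψ.comp continuousOn_snd fun z hz => hz.2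
  have hv' : ContinuousOn (fun z : ℝ × (Spc d × ℝ) => v z.2) (univ ×ˢ S) :=
    hv.comp continuousOn_snd fun z hz => hz.2
  have hb' : ∀ i, Continuous fun z : ℝ × (Spc d × ℝ) => b z.2 i := fun i =>
    (EuclideanSpace.proj (𝕜 := ℝ) i).continuous.comp (hb.comp continuous_snd)
  refine ((hψ'.mul (h1 _).continuousOn).add (hv'.mul (Continuous.continuousOn ?_))).sub
    (hψ'.mul (Continuous.continuousOn ?_))
  · exact (continuous_fst.pow 2).mul (continuous_finsetSum _ fun i _ => h2 _)
  · exact continuous_fst.mul (continuous_finsetSum _ fun i _ => (hb' i).mul (h1 _))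

theorem tsupport_time_mul_scale_subset {φ : Spc d × ℝ → ℝ} (c l : ℝ) :
    tsupport (fun q => timeCutoff c q.2 * φ (scaleSpace l q))
      ⊆ {q | 1 ≤ c * q.2 ∧ scaleSpace l q ∈ tsupport φ} := by
  refine closure_minimal (fun q hq => ?_) ?_
  · exact ⟨le_of_timeCutoff_ne_zero (left_ne_zero_of_mul hq),
      subset_tsupport _ (right_ne_zero_of_mul hq)⟩
  · exact (isClosed_le continuous_const (continuous_const.mul continuous_snd)).inter
      ((isClosed_tsupport φ).preimage (scaleSpace l).continuous)

/-- Testing against functions supported in the open cylinder suffices: push their support away from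
the lateral boundary by dilation and from the initial time by a monotone cutoff. -/
theorem setIntegral_weakIntegrand_nonpos {b : Spc d × ℝ → Spc d} {ψ v φ : Spc d × ℝ → ℝ}
    {U : Set (Spc d)} (hU : U = closedBall (0 : Spc d) 1 ∨ U = univ) {T : ℝ}
    (hb : Continuous b) (hψ : ContinuousOn ψ (U ×ˢ Icc 0 T)) (hψ0 : ∀ p, 0 ≤ ψ p)
    (hv : ContinuousOn v (U ×ˢ Icc 0 T)) (hφ : ContDiff ℝ (⊤ : ℕ∞) φ)
    (hφc : HasCompactSupport φ) (hφ0 : ∀ p, 0 ≤ φ p) (hφU : tsupport φ ⊆ U ×ˢ Iio T)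
    (H : ∀ η : Spc d × ℝ → ℝ, ContDiff ℝ (⊤ : ℕ∞) η → HasCompactSupport η → (∀ p, 0 ≤ η p) →
      tsupport η ⊆ interior U ×ˢ Ioo 0 T → ∫ p, weakIntegrand b ψ v η p ≤ 0) :
    ∫ p in univ ×ˢ Ioo 0 T, weakIntegrand b ψ v φ p ≤ 0 := by
  have hUc : IsClosed U := by
    rcases hU with rfl | rfl
    exacts [isClosed_closedBall, isClosed_univ]
  obtain ⟨R, hR⟩ : ∃ R, tsupport φ ⊆ closedBall 0 R := hφc.isBounded.subset_closedBall 0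
  set B := U ∩ closedBall (0 : Spc d) R
  have hBm : MeasurableSet (B ×ˢ Ioo 0 T) :=
    (hUc.inter isClosed_closedBall).measurableSet.prod measurableSet_Ioo
  have hcpt : IsCompact (B ×ˢ Icc 0 T) :=
    ((isCompact_closedBall _ _).inter_left hUc).prod isCompact_Icc
  have hBU : B ×ˢ Icc 0 T ⊆ U ×ˢ Icc 0 T := prod_mono inter_subset_left Subset.rfl
  have hBB : B ×ˢ Ioo 0 T ⊆ B ×ˢ Icc 0 T := prod_mono Subset.rfl Ioo_subset_Icc_self
  have hfin : volume (B ×ˢ Ioo 0 T) ≠ ∞ := ((measure_mono hBB).trans_lt hcpt.measure_lt_top).ne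
  have hφR : ∀ p ∈ tsupport φ, ‖p.1‖ ≤ R := fun p hp =>
    (norm_fst_le p).trans (mem_closedBall_zero_iff.1 (hR hp))
  have hcont := continuousOn_scaledIntegrand hb (hψ.mono hBU) (hv.mono hBU) hφ
  obtain ⟨C, hC⟩ := ((isCompact_Icc (a := (1 : ℝ)) (b := 2)).prod hcpt).exists_bound_of_continuousOn
    (hcont.mono (prod_mono (subset_univ _) Subset.rfl))
  have hcont_right : ∀ l, ContinuousOn (scaledIntegrand b ψ v φ l) (B ×ˢ Icc 0 T) := fun l =>
    hcont.comp (f := fun p => (l, p)) (by fun_prop) fun p hp => ⟨mem_univ _, hp⟩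
  have hset : ∫ p in univ ×ˢ Ioo 0 T, weakIntegrand b ψ v φ p
      = ∫ p in B ×ˢ Ioo 0 T, scaledIntegrand b ψ v φ 1 p := by
    simp_rw [scaledIntegrand_one]
    refine setIntegral_eq_of_subset_of_forall_sdiff_eq_zero
      (MeasurableSet.univ.prod measurableSet_Ioo) (prod_mono (subset_univ _) Subset.rfl)
      fun p hp => ?_
    by_contra h
    have h' := tsupport_weakIntegrand_subset b ψ v φ (subset_tsupport _ h)
    exact hp.2 ⟨⟨(hφU h').1, mem_closedBall_zero_iff.2 (hφR p h')⟩, hp.1.2⟩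
  set l : ℕ → ℝ := fun n => 1 + 1 / ((n : ℝ) + 1)
  have hl1 : ∀ n, 1 < l n := fun n => by
    have : 0 < 1 / ((n : ℝ) + 1) := by positivity
    exact lt_add_of_pos_right 1 this
  have hl2 : ∀ n, l n ≤ 2 := fun n => by
    have : 1 / ((n : ℝ) + 1) ≤ 1 := by
      rw [div_le_one (by positivity)]
      linarith [Nat.cast_nonneg (α := ℝ) n]
    linarith
  have hlt : Tendsto l atTop (𝓝 1) := by
    simpa [l] using (tendsto_const_nhds (x := (1 : ℝ))).add
      (tendsto_one_div_add_atTop_nhds_zero_nat (𝕜 := ℝ))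
  have hle : ∀ n : ℕ, ∫ p in B ×ˢ Ioo 0 T,
      timeCutoff (n + 1) p.2 * scaledIntegrand b ψ v φ (l n) p ≤ 0 := by
    intro n
    set η : Spc d × ℝ → ℝ := fun q => timeCutoff (n + 1) q.2 * φ (scaleSpace (l n) q)
    have hη : ContDiff ℝ (⊤ : ℕ∞) η :=
      ((contDiff_timeCutoff _).comp contDiff_snd).mul (hφ.comp (scaleSpace (l n)).contDiff)
    have hη0 : ∀ p, 0 ≤ η p := fun p =>
      mul_nonneg (Real.smoothTransition.nonneg _) (hφ0 _)
    have hsub : ∀ q ∈ tsupport η, q.1 ∈ interior U ∧ ‖q.1‖ ≤ R ∧ q.2 ∈ Ioo 0 T := by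
      intro q hq
      obtain ⟨h1, h2⟩ := tsupport_time_mul_scale_subset _ _ hq
      have hn : (0 : ℝ) < n + 1 := by positivity
      refine ⟨mem_interior_of_smul_mem hU (hl1 n) (hφU h2).1, ?_, ?_, (hφU h2).2⟩
      · have h3 := hφR _ h2
        rw [scaleSpace_apply, norm_smul, Real.norm_of_nonneg (by linarith [hl1 n])] at h3
        nlinarith [norm_nonneg q.1, hl1 n]
      · exact pos_of_mul_pos_right (zero_lt_one.trans_le h1) hn.le
    have hηB : tsupport η ⊆ B ×ˢ Ioo 0 T := fun q hq =>
      ⟨⟨interior_subset (hsub q hq).1, mem_closedBall_zero_iff.2 (hsub q hq).2.1⟩,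
        (hsub q hq).2.2⟩
    have hηΩ : tsupport η ⊆ interior U ×ˢ Ioo 0 T := fun q hq =>
      ⟨(hsub q hq).1, (hsub q hq).2.2⟩
    have hηc : HasCompactSupport η :=
      hcpt.of_isClosed_subset (isClosed_tsupport _) (hηB.trans hBB)
    have hΩU : interior U ×ˢ Ioo 0 T ⊆ U ×ˢ Icc 0 T :=
      prod_mono interior_subset Ioo_subset_Icc_self
    have hηi : Integrable (weakIntegrand b ψ v η) :=
      (continuous_weakIntegrand (isOpen_interior.prod isOpen_Ioo) hb (hψ.mono hΩU)
        (hv.mono hΩU) hη hηΩ).integrable_of_hasCompactSupport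
        (hηc.of_isClosed_subset (isClosed_tsupport _) (tsupport_weakIntegrand_subset b ψ v η))
    have hzero : ∀ p ∉ B ×ˢ Ioo 0 T, weakIntegrand b ψ v η p = 0 := fun p hp => by
      by_contra h
      exact hp (hηB (tsupport_weakIntegrand_subset b ψ v η (subset_tsupport _ h)))
    refine le_trans ?_ ((setIntegral_eq_integral_of_forall_compl_eq_zero hzero).trans_le
      (H η hη hηc hη0 hηΩ))
    refine setIntegral_mono_on ?_ hηi.integrableOn hBm fun p _ => ?_
    · refine (ContinuousOn.integrableOn_compact hcpt ?_).mono_set hBB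
      exact ((contDiff_timeCutoff _).continuous.comp continuous_snd).continuousOn.mul
        (hcont_right _)
    · rw [weakIntegrand_time_mul_scale hφ ((contDiff_timeCutoff _).differentiable (by simp))]
      refine le_add_of_nonneg_right (mul_nonneg (hψ0 p) (mul_nonneg ?_ (hφ0 _)))
      exact (monotone_timeCutoff (by positivity)).deriv_nonneg
  rw [hset]
  refine le_of_tendsto (tendsto_integral_of_dominated_convergence (fun _ => C) (fun n => ?_)
    (integrableOn_const hfin) (fun n => ?_) ?_) (Eventually.of_forall hle)
  · exact (((contDiff_timeCutoff _).continuous.comp continuous_snd).continuousOn.mul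
      ((hcont_right _).mono hBB)).aestronglyMeasurable hBm
  · refine (ae_restrict_iff' hBm).2 (Eventually.of_forall fun p hp => ?_)
    rw [norm_mul]
    refine (mul_le_of_le_one_left (norm_nonneg _) ?_).trans
      (hC (l n, p) ⟨⟨(hl1 n).le, hl2 n⟩, hBB hp⟩)
    rw [timeCutoff, Real.norm_of_nonneg (Real.smoothTransition.nonneg _)]
    exact Real.smoothTransition.le_one _
  · refine (ae_restrict_iff' hBm).2 (Eventually.of_forall fun p hp => ?_)
    have h1 : Continuous fun l => scaledIntegrand b ψ v φ l p := by
      have := hcont.comp (f := fun l => (l, p)) (s := univ) (by fun_prop)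
        fun l _ => ⟨mem_univ _, hBB hp⟩
      exact continuousOn_univ.1 this
    simpa using (tendsto_timeCutoff hp.2.1).mul ((h1.tendsto 1).comp hlt)

/-- (Lemma 2.6: a continuous function which is a classical
supersolution in its positive set, has Lipschitz `ψ^α` for some `α ∈ (0,m)`,
and whose free boundary has Hausdorff dimension `d-1`, is a weak supersolution
of `ψ_t = Δ(ψ^m) + ∇·(b ψ)` on `U × [0,T]`). -/
theorem weak_supersolution_criterion
    (d : ℕ) (hd : 1 ≤ d) (m : ℝ) (hm : 1 < m)
    (b : Spc d × ℝ → Spc d) (K : ℝ) (hb : C31Bound b K)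
    (U : Set (Spc d)) (hU : U = closedBall (0 : Spc d) 1 ∨ U = univ)
    (T : ℝ) (hT : 0 < T)
    (ψ : Spc d × ℝ → ℝ)
    (hψc : ContinuousOn ψ (U ×ˢ Icc (0:ℝ) T))
    (hψ0 : ∀ p, 0 ≤ ψ p)
    (hsmooth : ContDiffOn ℝ (⊤ : ℕ∞) ψ {p : Spc d × ℝ | 0 < ψ p})
    (hsuper : ∀ p ∈ {p : Spc d × ℝ | 0 < ψ p} ∩ (U ×ˢ Icc (0:ℝ) T),
      0 ≤ tderiv ψ p - slap (fun q => ψ q ^ m) p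
          - sdiv (fun q => ψ q • b q) p)
    (a : ℝ) (ha : a ∈ Ioo (0:ℝ) m)
    (hlip : ∃ Kl : ℝ≥0,
      LipschitzOnWith Kl (fun p => ψ p ^ a) (U ×ˢ Icc (0:ℝ) T))
    (hdim : dimH (frontier {p : Spc d × ℝ | 0 < ψ p}) = (d : ℝ≥0∞) - 1) :
    ∀ φ : Spc d × ℝ → ℝ, ContDiff ℝ (⊤ : ℕ∞) φ → HasCompactSupport φ →
      (∀ p, 0 ≤ φ p) → tsupport φ ⊆ U ×ˢ Iio T →
      (∫ p in (univ ×ˢ Ioo (0:ℝ) T),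
        (ψ p * tderiv φ p + ψ p ^ m * slap φ p - ψ p * ⟪b p, sgrad φ p⟫))
        ≤ ∫ x, ψ (x, 0) * φ (x, 0) := by

  obtain ⟨hbs, -⟩ := hb
  obtain ⟨L, hL⟩ := hlip
  intro φ hφ hφc hφ0 hφU
  have hm0 : m ≠ 0 := by linarith
  have hvc : ContinuousOn (fun q => ψ q ^ m) (U ×ˢ Icc (0 : ℝ) T) :=
    hψc.rpow_const fun _ _ => Or.inr (by linarith)
  have hΓ0 : Measure.hausdorffMeasure (d : ℝ) (frontier {p : Spc d × ℝ | 0 < ψ p}) = 0 := by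
    refine hausdorffMeasure_of_dimH_lt (d := (d : ℝ≥0)) ?_
    rw [hdim]
    refine ENNReal.sub_lt_self ?_ ?_ one_ne_zero <;> simp
    omega
  have hΩU : interior U ×ˢ Ioo 0 T ⊆ U ×ˢ Icc 0 T :=
    prod_mono interior_subset Ioo_subset_Icc_self
  have hΩ : IsOpen (interior U ×ˢ Ioo 0 T) := isOpen_interior.prod isOpen_Ioo
  refine le_trans ?_ (integral_nonneg fun x => mul_nonneg (hψ0 _) (hφ0 _))
  simp_rw [← weakIntegrand_eq (v := fun q => ψ q ^ m) hφ]
  refine setIntegral_weakIntegrand_nonpos hU hbs.continuous hψc hψ0 hvc hφ hφc hφ0 hφU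
    fun η hη hηc hη0 hηΩ => ?_
  refine integral_weakIntegrand_nonpos hd hΩ isClosed_frontier hΓ0 hbs (hψc.mono hΩU)
    (hvc.mono hΩU) ?_ ?_ ?_ ?_ hη hηc hη0 hηΩ
  · exact fun p hp => (contDiffAt_of_notMem_frontier hm0 hψ0 hsmooth hp.2).1.contDiffWithinAt
  · exact fun p hp => (contDiffAt_of_notMem_frontier hm0 hψ0 hsmooth hp.2).2.contDiffWithinAt
  · intro K hKΩ hK
    obtain ⟨C, hC⟩ := exists_norm_fderiv_le_of_rpow_lipschitz ha.1 ha.2.le hψ0 hΩ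
      (hψc.mono hΩU) (hL.mono hΩU) hKΩ hK
    exact ⟨C, fun p hp => hC p hp.1⟩
  · exact fun p hp => supersolution_of_notMem_frontier hm0 (hbs.differentiable (by simp)) hψ0
      hsmooth hp.2 fun h => hsuper p ⟨h, hΩU hp.1⟩

end
end
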